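/- arXiv:1209.0155 — 8 statements merged into one kernel-verified Lean document; each statement's English description precedes it below -/
import Mathlib

section
/- Let F and G be Cartan–Münzner polynomials on ℝⁿ of degrees m and p respectively, with p dividing m, and suppose that F(x) = T_{m/p}(G(x)) for all x on the unit sphere of ℝⁿ, or F(x) = −T_{m/p}(G(x)) for all x on the unit sphere. Then m = p, and F = G or F = −G. -/
noncomputable section

/-- `G` is a Cartan–Münzner polynomial of degree `p` on `ℝⁿ`. -/
def IsCartanMunzner (n p : ℕ) (G : EuclideanSpace ℝ (Fin n) → ℝ) : Prop :=
  ∃ P : MvPolynomial (Fin n) ℝ, P.IsHomogeneous p ∧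
    (∀ x : EuclideanSpace ℝ (Fin n), G x = MvPolynomial.eval (fun i => x i) P) ∧
    (∀ x : EuclideanSpace ℝ (Fin n), ‖gradient G x‖ ^ 2 = (p : ℝ) ^ 2 * ‖x‖ ^ (2 * p - 2)) ∧
    ∃ c : ℝ,
      (∀ x : EuclideanSpace ℝ (Fin n),
        (∑ i, MvPolynomial.eval (fun j => x j)
            (MvPolynomial.pderiv i (MvPolynomial.pderiv i P))) = c * ‖x‖ ^ (p - 2)) ∧
      (∃ mplus : ℕ, 0 < mplus ∧ ((n : ℝ) - 2) / (p : ℝ) + c / (p : ℝ) ^ 2 = (mplus : ℝ)) ∧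
      (∃ mminus : ℕ, 0 < mminus ∧ ((n : ℝ) - 2) / (p : ℝ) - c / (p : ℝ) ^ 2 = (mminus : ℝ))

namespace MvPolynomial

variable {n : ℕ}

/-- The formal squared norm `∑ i, X i ^ 2`. -/
def normSq (n : ℕ) : MvPolynomial (Fin n) ℝ := ∑ i, X i ^ 2

/-- The formal inner product of the gradients of two polynomials. -/
def gradInner (P Q : MvPolynomial (Fin n) ℝ) : MvPolynomial (Fin n) ℝ :=
  ∑ i, pderiv i P * pderiv i Q

/-- The formal Laplacian. -/
def lap (P : MvPolynomial (Fin n) ℝ) : MvPolynomial (Fin n) ℝ := ∑ i, pderiv i (pderiv i P)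

theorem pderiv_normSq (i : Fin n) : pderiv i (normSq n) = 2 * X i := by
  simp only [normSq, map_sum, Derivation.leibniz_pow, pderiv_X]
  rw [Finset.sum_eq_single i] <;> simp +contextual

theorem pderiv_two (i : Fin n) : pderiv i (2 : MvPolynomial (Fin n) ℝ) = 0 := by
  simpa using (pderiv i).map_natCast (R := ℝ) 2

theorem eval_normSq (x : EuclideanSpace ℝ (Fin n)) :
    eval (fun i => x i) (normSq n) = ‖x‖ ^ 2 := by
  simp [normSq, EuclideanSpace.norm_sq_eq]

theorem isHomogeneous_normSq : (normSq n).IsHomogeneous 2 :=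
  IsHomogeneous.sum _ _ _ fun i _ => by simpa using (isHomogeneous_X ℝ i).pow 2

theorem lap_mul (P Q : MvPolynomial (Fin n) ℝ) :
    lap (P * Q) = P * lap Q + Q * lap P + 2 * gradInner P Q := by
  simp only [lap, gradInner, Finset.mul_sum, ← Finset.sum_add_distrib]
  refine Finset.sum_congr rfl fun i _ => ?_
  simp only [Derivation.leibniz, map_add, smul_eq_mul]
  ring

theorem lap_sub (P Q : MvPolynomial (Fin n) ℝ) : lap (P - Q) = lap P - lap Q := by
  simp [lap]

theorem lap_normSq_pow (k : ℕ) :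
    normSq n * lap (normSq n ^ k) = C (2 * k * (2 * k - 2 + n) : ℝ) * normSq n ^ k := by
  rcases k with _ | k
  · simp [lap]
  rcases k with _ | k
  · simp only [lap, zero_add, pow_one, pderiv_normSq, Derivation.leibniz]
    simp [pderiv_two, map_ofNat C 2]
    ring
  have h : ∀ i : Fin n, pderiv i (pderiv i (normSq n ^ (k + 1 + 1))) =
      (((k : MvPolynomial (Fin n) ℝ) + 1 + 1) * (k + 1) * 4 : MvPolynomial (Fin n) ℝ) * normSq n ^ k * X i ^ 2
        + 2 * ((k : MvPolynomial (Fin n) ℝ) + 1 + 1) * normSq n ^ (k + 1) := by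
    intro i
    simp [Derivation.leibniz_pow, pderiv_normSq, Derivation.leibniz, pderiv_two]
    ring
  simp only [lap, h, Finset.sum_add_distrib, ← Finset.mul_sum]
  rw [← normSq]
  simp [map_ofNat]
  ring

theorem IsHomogeneous.eval_smul {m : ℕ} {P : MvPolynomial (Fin n) ℝ} (hP : P.IsHomogeneous m)
    (c : ℝ) (x : Fin n → ℝ) : eval (fun i => c * x i) P = c ^ m * eval x P := by
  rw [eval_eq, eval_eq, Finset.mul_sum]
  refine Finset.sum_congr rfl fun d hd => ?_
  have hdm := hP (mem_support_iff.1 hd)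
  rw [Finsupp.weight_apply, Finsupp.sum] at hdm
  simp only [mul_pow, Finset.prod_mul_distrib, Finset.prod_pow_eq_pow_sum]
  simp at hdm
  rw [hdm]
  ring

theorem IsHomogeneous.eq_of_eval_sphere {m : ℕ} {P Q : MvPolynomial (Fin n) ℝ} (hn : 0 < n)
    (hP : P.IsHomogeneous m) (hQ : Q.IsHomogeneous m)
    (h : ∀ x : EuclideanSpace ℝ (Fin n), ‖x‖ = 1 →
      eval (fun i => x i) P = eval (fun i => x i) Q) : P = Q := by
  refine MvPolynomial.funext fun v => ?_
  have hu : ∃ u : EuclideanSpace ℝ (Fin n), ‖u‖ = 1 ∧ ∃ c : ℝ, v = fun i => c * u i := by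
    by_cases hv : WithLp.toLp 2 v = 0
    · refine ⟨EuclideanSpace.single ⟨0, hn⟩ 1, by simp, 0, ?_⟩
      ext i
      simpa using congrArg (fun y : EuclideanSpace ℝ (Fin n) => y i) hv
    · refine ⟨‖WithLp.toLp 2 v‖⁻¹ • WithLp.toLp 2 v, norm_smul_inv_norm hv, ‖WithLp.toLp 2 v‖, ?_⟩
      ext i
      simp [mul_inv_cancel_left₀ (norm_ne_zero_iff.2 hv)]
  obtain ⟨u, hu, c, rfl⟩ := hu
  rw [hP.eval_smul, hQ.eval_smul, h u hu]

theorem hasStrictFDerivAt_eval (P : MvPolynomial (Fin n) ℝ) (x : EuclideanSpace ℝ (Fin n)) :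
    HasStrictFDerivAt (fun y : EuclideanSpace ℝ (Fin n) => eval (fun i => y i) P)
      (∑ i, eval (fun j => x j) (pderiv i P) • EuclideanSpace.proj (𝕜 := ℝ) i) x := by
  induction P using MvPolynomial.induction_on with
  | C a => simpa using hasStrictFDerivAt_const a x
  | add p q hp hq =>
    have hf : (fun y : EuclideanSpace ℝ (Fin n) => eval (fun i => y i) (p + q)) =
        (fun y : EuclideanSpace ℝ (Fin n) => eval (fun i => y i) p) +
          fun y : EuclideanSpace ℝ (Fin n) => eval (fun i => y i) q := by
      ext y
      simp
    rw [hf]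
    refine (hp.add hq).congr_fderiv ?_
    simp [add_smul, Finset.sum_add_distrib]
  | mul_X p i hp =>
    have hi : HasStrictFDerivAt (fun y : EuclideanSpace ℝ (Fin n) => y i)
        (EuclideanSpace.proj (𝕜 := ℝ) i) x :=
      (EuclideanSpace.proj (𝕜 := ℝ) i).hasStrictFDerivAt
    have hf : (fun y : EuclideanSpace ℝ (Fin n) => eval (fun j => y j) (p * X i)) =
        (fun y : EuclideanSpace ℝ (Fin n) => eval (fun j => y j) p) *
          fun y : EuclideanSpace ℝ (Fin n) => y i := by
      ext y
      simp
    rw [hf]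
    refine (hp.mul hi).congr_fderiv ?_
    ext v
    simp [Derivation.leibniz, pderiv_X, add_mul, Finset.sum_add_distrib, Finset.mul_sum,
      Pi.single_apply, mul_assoc, apply_ite]

theorem norm_gradient_eval_sq (P : MvPolynomial (Fin n) ℝ) (x : EuclideanSpace ℝ (Fin n)) :
    ‖gradient (fun y : EuclideanSpace ℝ (Fin n) => eval (fun i => y i) P) x‖ ^ 2 =
      eval (fun i => x i) (gradInner P P) := by
  have h : HasGradientAt (fun y : EuclideanSpace ℝ (Fin n) => eval (fun i => y i) P)
      (WithLp.toLp 2 fun i => eval (fun j => x j) (pderiv i P)) x := by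
    rw [hasGradientAt_iff_hasFDerivAt]
    refine (hasStrictFDerivAt_eval P x).hasFDerivAt.congr_fderiv ?_
    ext v
    simp [PiLp.inner_apply, mul_comm]
  rw [h.gradient, EuclideanSpace.norm_sq_eq]
  simp [gradInner, sq]

end MvPolynomial

open Polynomial Polynomial.Chebyshev in
theorem Polynomial.Chebyshev.T_sq_sub_one (k : ℤ) :
    T ℝ (k + 1) ^ 2 - 1 = (X ^ 2 - 1) * U ℝ k ^ 2 := by
  have h₁ := congrArg (fun Q : ℝ[X] => Q.comp (2 * X)) (S_sq_add_S_sq ℝ k)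
  have h₂ := U_eq_X_mul_U_add_T ℝ k
  simp only [add_comp, sub_comp, mul_comp, pow_comp, X_comp, one_comp, S_comp_two_mul_X] at h₁
  rw [show T ℝ (k + 1) = U ℝ (k + 1) - X * U ℝ k by rw [h₂]; ring]
  linear_combination h₁

namespace MvPolynomial

variable {n : ℕ}

/-- The homogenization, with respect to the squared norm, of the composition of the Chebyshev
polynomial `U_k` with a polynomial of degree `p`. -/
def homogChebyshevU (p : ℕ) (P : MvPolynomial (Fin n) ℝ) : ℕ → MvPolynomial (Fin n) ℝ
  | 0 => 1
  | 1 => 2 * P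
  | k + 2 => 2 * P * homogChebyshevU p P (k + 1) - normSq n ^ p * homogChebyshevU p P k

theorem isHomogeneous_homogChebyshevU {p : ℕ} {P : MvPolynomial (Fin n) ℝ}
    (hP : P.IsHomogeneous p) (k : ℕ) : (homogChebyshevU p P k).IsHomogeneous (p * k) := by
  have h₂ : (2 * P).IsHomogeneous p := by
    simpa [map_ofNat C 2] using (isHomogeneous_C (Fin n) (2 : ℝ)).mul hP
  induction k using Nat.twoStepInduction with
  | zero => simpa [homogChebyshevU] using isHomogeneous_one (Fin n) ℝ
  | one => simpa [homogChebyshevU] using h₂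
  | more k ih₀ ih₁ =>
    refine IsHomogeneous.sub ?_ ?_
    · rw [show p * (k + 2) = p + p * (k + 1) by ring]
      exact h₂.mul ih₁
    · rw [show p * (k + 2) = 2 * p + p * k by ring]
      exact (isHomogeneous_normSq.pow p).mul ih₀

theorem eval_homogChebyshevU {p : ℕ} {P : MvPolynomial (Fin n) ℝ}
    {x : EuclideanSpace ℝ (Fin n)} (hx : ‖x‖ = 1) (k : ℕ) :
    eval (fun i => x i) (homogChebyshevU p P k) =
      (Polynomial.Chebyshev.U ℝ k).eval (eval (fun i => x i) P) := by
  induction k using Nat.twoStepInduction with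
  | zero => simp [homogChebyshevU]
  | one => simp [homogChebyshevU]
  | more k ih₀ ih₁ =>
    have h := Polynomial.Chebyshev.U_add_two ℝ (k : ℤ)
    push_cast at ih₁ ⊢
    simp [homogChebyshevU, h, ih₀, ih₁, eval_normSq, hx]

theorem pderiv_sq_sub_normSq_pow (p : ℕ) (P : MvPolynomial (Fin n) ℝ)
    (i : Fin n) :
    pderiv i (P ^ 2 - normSq n ^ p) =
      2 * P * pderiv i P - 2 * (p : MvPolynomial (Fin n) ℝ) * normSq n ^ (p - 1) * X i := by
  simp [Derivation.leibniz_pow, pderiv_normSq]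
  ring

/-- A Cartan–Münzner polynomial, with the equations it satisfies in polynomial form: `c` is the
value of its Laplacian on the unit sphere. -/
structure IsMunzner (p : ℕ) (P : MvPolynomial (Fin n) ℝ) (c : ℝ) : Prop where
  two_lt : 2 < n
  pos : 0 < p
  hom : P.IsHomogeneous p
  gradInner_self : gradInner P P = C ((p : ℝ) ^ 2) * normSq n ^ (p - 1)
  eval_lap : ∀ x : EuclideanSpace ℝ (Fin n), ‖x‖ = 1 → eval (fun i => x i) (lap P) = c
  abs_lt : |c| < p * (n - 2)

namespace IsMunzner

variable {p : ℕ} {P : MvPolynomial (Fin n) ℝ} {c : ℝ}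

theorem eval_lap_sq_sub (h : IsMunzner p P c) {x : EuclideanSpace ℝ (Fin n)} (hx : ‖x‖ = 1) :
    eval (fun i => x i) (lap (P ^ 2 - normSq n ^ p)) =
      2 * eval (fun i => x i) P * c - 2 * p ^ 2 - 2 * p * (n - 2) := by
  have h₁ := congrArg (eval fun i => x i) (lap_normSq_pow (n := n) p)
  simp only [map_mul, map_pow, eval_normSq, hx, eval_C] at h₁
  simp only [lap_sub, sq P, lap_mul, h.gradInner_self, map_sub, map_add, map_mul, map_pow,
    h.eval_lap x hx, eval_normSq, hx, eval_C]
  simp only [one_pow, one_mul, mul_one] at h₁ ⊢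
  simp [h₁]
  ring

theorem gradInner_sq_sub (h : IsMunzner p P c) :
    gradInner (P ^ 2 - normSq n ^ p) (P ^ 2 - normSq n ^ p) =
      - 4 * C ((p : ℝ) ^ 2) * normSq n ^ (p - 1) * (P ^ 2 - normSq n ^ p) := by
  have h₁ : gradInner (P ^ 2 - normSq n ^ p) (P ^ 2 - normSq n ^ p) =
      4 * P ^ 2 * gradInner P P - 8 * (p : MvPolynomial (Fin n) ℝ) * P * normSq n ^ (p - 1) * (∑ i, X i * pderiv i P)
        + 4 * (p : MvPolynomial (Fin n) ℝ) ^ 2 * (normSq n ^ (p - 1)) ^ 2 * normSq n := by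
    simp only [gradInner, pderiv_sq_sub_normSq_pow]
    conv_rhs => enter [2, 2]; rw [normSq]
    rw [Finset.mul_sum, Finset.mul_sum, Finset.mul_sum, ← Finset.sum_sub_distrib,
      ← Finset.sum_add_distrib]
    refine Finset.sum_congr rfl fun i _ => ?_
    ring
  have h₂ : normSq n ^ p = normSq n ^ (p - 1) * normSq n := by
    rw [← pow_succ, Nat.sub_add_cancel h.pos]
  rw [h₁, h.hom.sum_X_mul_pderiv, h.gradInner_self, h₂]
  simp
  ring

theorem sq_sub_ne_zero (h : IsMunzner p P c) : P ^ 2 - normSq n ^ p ≠ 0 := by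
  intro h₀
  have hn := h.two_lt
  let x : EuclideanSpace ℝ (Fin n) := EuclideanSpace.single ⟨0, by omega⟩ 1
  have hx : ‖x‖ = 1 := by simp [x]
  have h₁ := h.eval_lap_sq_sub hx
  have h₂ := congrArg (eval fun i => x i) h₀
  have h₃ := h.abs_lt
  have h₄ : (0 : ℝ) < p := by exact_mod_cast h.pos
  simp only [map_sub, map_pow, eval_normSq, hx, map_zero] at h₂
  rw [h₀] at h₁
  simp only [lap, map_zero, Finset.sum_const_zero] at h₁
  rw [_root_.abs_lt] at h₃
  have h₅ : eval (fun i => x i) P = 1 ∨ eval (fun i => x i) P = -1 := by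
    rw [← sub_eq_zero, ← sub_eq_zero (b := (-1 : ℝ)), ← mul_eq_zero]
    linear_combination h₂
  rcases h₅ with h₅ | h₅ <;> rw [h₅] at h₁ <;> nlinarith

/-- A zero of the cofactor of a Pell-type identity between two Cartan–Münzner polynomials forces
one of the multiplicities to vanish. -/
theorem eval_ne_zero_of_pell {m : ℕ} {F V : MvPolynomial (Fin n) ℝ} {b : ℝ}
    (hF : IsMunzner m F b) (h : IsMunzner p P c)
    (hV : F ^ 2 - normSq n ^ m = (P ^ 2 - normSq n ^ p) * V ^ 2)
    {x : EuclideanSpace ℝ (Fin n)} (hx : ‖x‖ = 1) : eval (fun i => x i) V ≠ 0 := by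
  intro hVx
  set A := P ^ 2 - normSq n ^ p with hA
  have hA₀ : A ≠ 0 := h.sq_sub_ne_zero
  have hV₀ : V ≠ 0 := by
    rintro rfl
    exact hF.sq_sub_ne_zero (by simp [hV])
  have h₁ : gradInner (A * V ^ 2) (A * V ^ 2) =
      V ^ 4 * gradInner A A + 4 * A * V ^ 3 * gradInner A V
        + 4 * A ^ 2 * V ^ 2 * gradInner V V := by
    simp only [gradInner, Finset.mul_sum, ← Finset.sum_add_distrib]
    refine Finset.sum_congr rfl fun i _ => ?_
    simp [Derivation.leibniz, Derivation.leibniz_pow]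
    ring
  have h₂ := hF.gradInner_sq_sub
  rw [hV, h₁, h.gradInner_sq_sub] at h₂
  have h₃ : -4 * C ((p : ℝ) ^ 2) * normSq n ^ (p - 1) * V ^ 2 + 4 * V * gradInner A V
      + 4 * A * gradInner V V = -4 * C ((m : ℝ) ^ 2) * normSq n ^ (m - 1) := by
    refine mul_left_cancel₀ (mul_ne_zero hA₀ (pow_ne_zero 2 hV₀)) ?_
    linear_combination h₂
  have h₄ := congrArg (eval fun i => x i) h₃
  have h₅ := hF.eval_lap_sq_sub hx
  have h₆ := congrArg (eval fun i => x i) hV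
  have h₇ : lap (V ^ 2) = 2 * V * lap V + 2 * gradInner V V := by
    rw [sq, lap_mul]; ring
  have h₈ : gradInner A (V ^ 2) = 2 * V * gradInner A V := by
    simp only [gradInner, Finset.mul_sum]
    refine Finset.sum_congr rfl fun i _ => ?_
    simp [Derivation.leibniz_pow]
    ring
  rw [hV, lap_mul, h₇, h₈] at h₅
  simp only [map_add, map_sub, map_mul, map_pow, map_neg, map_ofNat, eval_normSq, hx, eval_C,
    hVx] at h₄ h₅ h₆
  have h₉ := hF.abs_lt
  simp only [one_pow, mul_one, mul_zero, zero_mul, zero_add, add_zero, ne_eq, OfNat.ofNat_ne_zero,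
    not_false_eq_true, zero_pow] at h₄ h₅ h₆
  have hFb : eval (fun i => x i) F * b = m * (n - 2) := by
    linear_combination (1 / 4 : ℝ) * h₄ - (1 / 2 : ℝ) * h₅
  have hF₁ : |eval (fun i => x i) F| = 1 := by
    rw [← pow_eq_one_iff_of_nonneg (abs_nonneg _) two_ne_zero, sq_abs]
    linarith
  rw [← hFb] at h₉
  have := le_abs_self (eval (fun i => x i) F * b)
  rw [abs_mul, hF₁, one_mul] at this
  linarith

/-- An extremum on the unit sphere has value `±1`. -/
theorem eval_sq_eq_one_of_isExtrOn (h : IsMunzner p P c) {x : EuclideanSpace ℝ (Fin n)}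
    (hx : ‖x‖ = 1)
    (hext : IsExtrOn (fun y : EuclideanSpace ℝ (Fin n) => eval (fun i => y i) P)
      (Metric.sphere 0 1) x) : eval (fun i => x i) P ^ 2 = 1 := by
  have hs : Metric.sphere (0 : EuclideanSpace ℝ (Fin n)) 1 = {y | ‖y‖ ^ 2 = ‖x‖ ^ 2} := by
    ext y
    rw [mem_sphere_zero_iff_norm, Set.mem_ofPred_eq, hx,
      sq_eq_sq₀ (norm_nonneg _) zero_le_one]
  rw [hs] at hext
  obtain ⟨a, b, hab, hsum⟩ := hext.localize.exists_multipliers_of_hasStrictFDerivAt_1d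
    (hasStrictFDerivAt_norm_sq x) (hasStrictFDerivAt_eval P x)
  have h₁ : ∀ i, 2 * a * x i + b * eval (fun j => x j) (pderiv i P) = 0 := by
    intro i
    have := DFunLike.congr_fun hsum (EuclideanSpace.single i 1)
    simp [EuclideanSpace.inner_single_right] at this
    linear_combination this
  have hp : (p : ℝ) ≠ 0 := by exact_mod_cast h.pos.ne'
  have h₂ : ∑ i, eval (fun j => x j) (pderiv i P) * eval (fun j => x j) (pderiv i P) =
      (p : ℝ) ^ 2 := by
    simpa [gradInner, eval_normSq, hx] using congrArg (eval fun i => x i) h.gradInner_self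
  have h₃ : ∑ i, x i * eval (fun j => x j) (pderiv i P) = p * eval (fun j => x j) P := by
    simpa using congrArg (eval fun i => x i) h.hom.sum_X_mul_pderiv
  have h₄ : ∑ i, x i * x i = 1 := by
    simpa [hx, sq] using (EuclideanSpace.norm_sq_eq x).symm
  have h₅ : 2 * a * (p * eval (fun j => x j) P) + b * (p : ℝ) ^ 2 = 0 := by
    rw [← h₂, ← h₃, Finset.mul_sum, Finset.mul_sum, ← Finset.sum_add_distrib]
    refine Finset.sum_eq_zero fun i _ => ?_
    linear_combination eval (fun j => x j) (pderiv i P) * h₁ i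
  have h₆ : 2 * a + b * (p * eval (fun j => x j) P) = 0 := by
    rw [← mul_one (2 * a), ← h₄, ← h₃, Finset.mul_sum, Finset.mul_sum, ← Finset.sum_add_distrib]
    refine Finset.sum_eq_zero fun i _ => ?_
    linear_combination x i * h₁ i
  have hb : b ≠ 0 := by
    rintro rfl
    refine hab ?_
    have : a = 0 := by linarith
    simp [this]
  refine mul_left_cancel₀ (mul_ne_zero hb (pow_ne_zero 2 hp)) ?_
  linear_combination p * eval (fun j => x j) P * h₆ - h₅

theorem exists_eval_eq (h : IsMunzner p P c) {t : ℝ} (ht : t ∈ Set.Icc (-1 : ℝ) 1) :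
    ∃ x : EuclideanSpace ℝ (Fin n), ‖x‖ = 1 ∧ eval (fun i => x i) P = t := by
  have hn := h.two_lt
  have : Nontrivial (EuclideanSpace ℝ (Fin n)) :=
    Module.nontrivial_of_finrank_pos (R := ℝ) (by simp; omega)
  have hcont : Continuous fun y : EuclideanSpace ℝ (Fin n) => eval (fun i => y i) P :=
    continuous_iff_continuousAt.2 fun y => (hasStrictFDerivAt_eval P y).continuousAt
  have hne : (Metric.sphere (0 : EuclideanSpace ℝ (Fin n)) 1).Nonempty :=
    NormedSpace.sphere_nonempty.2 zero_le_one
  obtain ⟨u, hu, humin⟩ := (isCompact_sphere _ _).exists_isMinOn hne hcont.continuousOn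
  obtain ⟨v, hv, hvmax⟩ := (isCompact_sphere _ _).exists_isMaxOn hne hcont.continuousOn
  have hu₁ := h.eval_sq_eq_one_of_isExtrOn (mem_sphere_zero_iff_norm.1 hu) (Or.inl humin)
  have hv₁ := h.eval_sq_eq_one_of_isExtrOn (mem_sphere_zero_iff_norm.1 hv) (Or.inr hvmax)
  have hlt : eval (fun i => u i) P < eval (fun i => v i) P := by
    refine lt_of_le_of_ne (humin hv) fun heq => h.sq_sub_ne_zero ?_
    have hhom := h.hom.pow 2
    rw [mul_comm] at hhom
    rw [sub_eq_zero]
    refine hhom.eq_of_eval_sphere (by omega) (isHomogeneous_normSq.pow p) fun x hx => ?_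
    have hx' := mem_sphere_zero_iff_norm.2 hx
    have hxu : eval (fun i => x i) P = eval (fun i => u i) P :=
      le_antisymm (heq ▸ hvmax hx') (humin hx')
    simp [hxu, hu₁, eval_normSq, hx]
  have huv : eval (fun i => u i) P = -eval (fun i => v i) P :=
    (sq_eq_sq_iff_eq_or_eq_neg.1 (hu₁.trans hv₁.symm)).resolve_left hlt.ne
  have hv₂ : eval (fun i => v i) P = 1 :=
    (pow_eq_one_iff_of_nonneg (by linarith) two_ne_zero).1 hv₁
  rw [hv₂] at huv
  have hrank : 1 < Module.rank ℝ (EuclideanSpace ℝ (Fin n)) := by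
    rw [← Module.finrank_eq_rank]
    simp
    omega
  obtain ⟨x, hx, hxt⟩ := (isPreconnected_sphere hrank 0 1).intermediate_value hu hv
    hcont.continuousOn (show t ∈ Set.Icc _ _ from ⟨huv.trans_le ht.1, ht.2.trans_eq hv₂.symm⟩)
  exact ⟨x, mem_sphere_zero_iff_norm.1 hx, hxt⟩

end IsMunzner

end MvPolynomial

open MvPolynomial in
theorem IsCartanMunzner.exists_isMunzner {n p : ℕ} {G : EuclideanSpace ℝ (Fin n) → ℝ}
    (hG : IsCartanMunzner n p G) :
    ∃ (P : MvPolynomial (Fin n) ℝ) (c : ℝ), P.IsMunzner p c ∧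
      ∀ x : EuclideanSpace ℝ (Fin n), G x = eval (fun i => x i) P := by
  obtain ⟨P, hP, hGP, hgrad, c, hlap, ⟨m₁, hm₁, h₁⟩, m₂, hm₂, h₂⟩ := hG
  have hm₁' : (0 : ℝ) < m₁ := by exact_mod_cast hm₁
  have hm₂' : (0 : ℝ) < m₂ := by exact_mod_cast hm₂
  have hp : 0 < p := by
    rcases Nat.eq_zero_or_pos p with rfl | hp
    · simp at h₁
      exact absurd h₁ hm₁'.ne
    · exact hp
  have hp' : (0 : ℝ) < p := by exact_mod_cast hp
  have e₁ : p * ((n : ℝ) - 2) + c = m₁ * p ^ 2 := by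
    rw [← h₁]
    field_simp
  have e₂ : p * ((n : ℝ) - 2) - c = m₂ * p ^ 2 := by
    rw [← h₂]
    field_simp
  have l₁ : 0 < p * ((n : ℝ) - 2) + c := e₁ ▸ by positivity
  have l₂ : 0 < p * ((n : ℝ) - 2) - c := e₂ ▸ by positivity
  obtain rfl : G = fun x => eval (fun i => x i) P := funext hGP
  refine ⟨P, c, ⟨?_, hp, hP, ?_, ?_, ?_⟩, hGP⟩
  · have : 0 < (n : ℝ) - 2 := pos_of_mul_pos_right (a := (p : ℝ)) (by linarith) hp'.le
    exact_mod_cast sub_pos.1 this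
  · refine MvPolynomial.funext fun v => ?_
    have h := hgrad (WithLp.toLp 2 v)
    have hq := eval_normSq (WithLp.toLp 2 v)
    rw [norm_gradient_eval_sq, show 2 * p - 2 = 2 * (p - 1) by omega, pow_mul, ← hq] at h
    simpa using h
  · intro x hx
    simpa [lap, hx] using hlap x
  · rw [abs_lt]
    constructor <;> linarith

/-- Cartan–Münzner polynomials are primitive: if a CM-polynomial `F` of degree `m` is (up to
sign) the Chebyshev composition `T_{m/p}` of a CM-polynomial `G` of degree `p` on the unit
sphere, then `m = p` and `F ≅ G`. -/
theorem cartanMunzner_primitive {n m p : ℕ}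
    (F G : EuclideanSpace ℝ (Fin n) → ℝ)
    (hF : IsCartanMunzner n m F) (hG : IsCartanMunzner n p G) (hdvd : p ∣ m)
    (hcomp :
      (∀ x : EuclideanSpace ℝ (Fin n), ‖x‖ = 1 →
        F x = (Polynomial.Chebyshev.T ℝ ((m / p : ℕ) : ℤ)).eval (G x)) ∨
      (∀ x : EuclideanSpace ℝ (Fin n), ‖x‖ = 1 →
        F x = -(Polynomial.Chebyshev.T ℝ ((m / p : ℕ) : ℤ)).eval (G x))) :
    m = p ∧ (F = G ∨ F = -G) := by
  obtain ⟨P, b, hP, hFP⟩ := hF.exists_isMunzner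
  obtain ⟨Q, c, hQ, hGQ⟩ := hG.exists_isMunzner
  obtain ⟨k, rfl⟩ := hdvd
  have hp := hQ.pos
  have hn := hQ.two_lt
  simp only [Nat.mul_div_cancel_left k hp, hFP, hGQ] at hcomp
  match k, hP, hcomp with
  | 0, hP, _ => exact absurd hP.pos (by simp)
  | 1, hP, hcomp =>
    simp only [mul_one] at hP
    refine ⟨mul_one p, ?_⟩
    rcases hcomp with h | h
    · have : P = Q := hP.hom.eq_of_eval_sphere (by omega) hQ.hom fun x hx => by simpa using h x hx
      exact Or.inl (funext fun x => by rw [hFP, hGQ, this])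
    · have : P = -Q := hP.hom.eq_of_eval_sphere (by omega) hQ.hom.neg
        fun x hx => by simpa using h x hx
      exact Or.inr (funext fun x => by simp [hFP, hGQ, this])
  | j + 2, hP, hcomp =>
    exfalso
    have hV : P ^ 2 - MvPolynomial.normSq n ^ (p * (j + 2)) =
        (Q ^ 2 - MvPolynomial.normSq n ^ p) *
          MvPolynomial.homogChebyshevU p Q (j + 1) ^ 2 := by
      refine MvPolynomial.IsHomogeneous.eq_of_eval_sphere (m := 2 * (p * (j + 2))) (by omega)
        ?_ ?_ fun x hx => ?_
      · refine MvPolynomial.IsHomogeneous.sub ?_ (MvPolynomial.isHomogeneous_normSq.pow _)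
        rw [mul_comm 2]
        exact hP.hom.pow 2
      · rw [show 2 * (p * (j + 2)) = 2 * p + p * (j + 1) * 2 by ring]
        refine (MvPolynomial.IsHomogeneous.sub ?_ (MvPolynomial.isHomogeneous_normSq.pow _)).mul
          ((MvPolynomial.isHomogeneous_homogChebyshevU hQ.hom _).pow 2)
        rw [mul_comm 2]
        exact hQ.hom.pow 2
      · have hT := congrArg (Polynomial.eval (MvPolynomial.eval (fun i => x i) Q))
          (Polynomial.Chebyshev.T_sq_sub_one (j + 1))
        have hPT : MvPolynomial.eval (fun i => x i) P ^ 2 =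
            ((Polynomial.Chebyshev.T ℝ (j + 1 + 1)).eval
              (MvPolynomial.eval (fun i => x i) Q)) ^ 2 := by
          have hj : ((j + 2 : ℕ) : ℤ) = j + 1 + 1 := by push_cast; ring
          rw [hj] at hcomp
          rcases hcomp with h | h <;> rw [h x hx]
          ring
        simp only [map_sub, map_mul, map_pow, MvPolynomial.eval_normSq, hx,
          MvPolynomial.eval_homogChebyshevU hx, hPT]
        simpa using hT
    obtain ⟨x, hx, hxQ⟩ := hQ.exists_eval_eq (t := Real.cos (Real.pi / (j + 2)))
      ⟨Real.neg_one_le_cos _, Real.cos_le_one _⟩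
    refine hP.eval_ne_zero_of_pell hQ hV hx ?_
    rw [MvPolynomial.eval_homogChebyshevU hx, hxQ]
    have hU := Polynomial.Chebyshev.U_real_cos (Real.pi / (j + 2)) ((j + 1 : ℕ) : ℤ)
    have hj : (((j + 1 : ℕ) : ℤ) : ℝ) + 1 = j + 2 := by push_cast; ring
    rw [hj, mul_div_cancel₀ _ (by positivity), Real.sin_pi] at hU
    refine (mul_eq_zero.1 hU).resolve_right (Real.sin_pos_of_pos_of_lt_pi (by positivity) ?_).ne'
    exact div_lt_self Real.pi_pos (by linarith [(Nat.cast_nonneg j : (0 : ℝ) ≤ j)])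
end
end

section
/- Let n ≥ 1, m ≥ 1, and let F : ℝⁿ → ℝ be a homogeneous polynomial of degree m satisfying ‖∇F(x)‖² = m²‖x‖^(2m−2) for all x ∈ ℝⁿ. If F is constant on the unit sphere of ℝⁿ, then m is even and either F(x) = ‖x‖^m for all x or F(x) = −‖x‖^m for all x. -/
noncomputable section

/-- `F` is the evaluation of a homogeneous `MvPolynomial` of degree `m` in `n` variables. -/
def IsHomPoly (n m : ℕ) (F : EuclideanSpace ℝ (Fin n) → ℝ) : Prop :=
  ∃ P : MvPolynomial (Fin n) ℝ, P.IsHomogeneous m ∧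
    ∀ x : EuclideanSpace ℝ (Fin n), F x = MvPolynomial.eval (fun i => x i) P

theorem IsHomPoly.map_smul {n m : ℕ} {F : EuclideanSpace ℝ (Fin n) → ℝ} (hF : IsHomPoly n m F)
    (t : ℝ) (x : EuclideanSpace ℝ (Fin n)) : F (t • x) = t ^ m * F x := by
  obtain ⟨P, hP, hPF⟩ := hF
  rw [hPF, hPF, MvPolynomial.eval_eq, MvPolynomial.eval_eq, Finset.mul_sum]
  refine Finset.sum_congr rfl fun d hd => ?_
  have hdeg : ∑ i ∈ d.support, d i = m := by
    rw [← hP (MvPolynomial.mem_support_iff.mp hd), Finsupp.weight_apply]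
    simp [Finsupp.sum]
  simp only [PiLp.smul_apply, smul_eq_mul, mul_pow, Finset.prod_mul_distrib,
    Finset.prod_pow_eq_pow_sum, hdeg]
  ring

/-- A homogeneous polynomial of positive degree that is constant on the unit sphere is a multiple
of a power of the norm. -/
theorem IsHomPoly.eq_mul_norm_pow {n m : ℕ} (hm : m ≠ 0) {F : EuclideanSpace ℝ (Fin n) → ℝ}
    (hF : IsHomPoly n m F) {c : ℝ} (hc : ∀ x, ‖x‖ = 1 → F x = c)
    (x : EuclideanSpace ℝ (Fin n)) : F x = c * ‖x‖ ^ m := by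
  rcases eq_or_ne x 0 with rfl | hx
  · simpa [hm] using hF.map_smul 0 0
  · have hx' : ‖x‖ ≠ 0 := norm_ne_zero_iff.mpr hx
    calc F x = F (‖x‖ • ‖x‖⁻¹ • x) := by rw [smul_inv_smul₀ hx']
      _ = c * ‖x‖ ^ m := by
        rw [hF.map_smul, hc _ (by simp [norm_smul, hx']), mul_comm]

theorem hasGradientAt_norm_pow_two_mul {E : Type*} [NormedAddCommGroup E] [InnerProductSpace ℝ E]
    [CompleteSpace E] (c : ℝ) (k : ℕ) (x : E) :
    HasGradientAt (fun y : E => c * ‖y‖ ^ (2 * k))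
      ((c * (2 * k * ‖x‖ ^ (2 * (k - 1)))) • x) x := by
  rw [hasGradientAt_iff_hasFDerivAt]
  have h := (((hasStrictFDerivAt_norm_sq x).hasFDerivAt).pow k).const_mul c
  simp only [← pow_mul] at h
  refine h.congr_fderiv ?_
  ext y
  simp
  ring

/-- If a homogeneous polynomial solution of `‖∇F(x)‖² = m²‖x‖^(2m-2)` is constant on the unit
sphere, then `m` is even and `F(x) = ±‖x‖^m`. -/
theorem radial_of_constant_on_sphere {n m : ℕ} (hn : 1 ≤ n) (hm : 1 ≤ m)
    (F : EuclideanSpace ℝ (Fin n) → ℝ) (hF : IsHomPoly n m F)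
    (hgrad : ∀ x : EuclideanSpace ℝ (Fin n),
      ‖gradient F x‖ ^ 2 = (m : ℝ) ^ 2 * ‖x‖ ^ (2 * m - 2))
    (hconst : ∀ x y : EuclideanSpace ℝ (Fin n), ‖x‖ = 1 → ‖y‖ = 1 → F x = F y) :
    Even m ∧ ((∀ x, F x = ‖x‖ ^ m) ∨ (∀ x, F x = -‖x‖ ^ m)) := by
  obtain ⟨e, he⟩ : ∃ e : EuclideanSpace ℝ (Fin n), ‖e‖ = 1 :=
    ⟨EuclideanSpace.single ⟨0, hn⟩ 1, by simp⟩
  have hm0 : (m : ℝ) ≠ 0 := by positivity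
  have hFnorm := hF.eq_mul_norm_pow (by lia) fun x hx => hconst x e hx he
  have hgrad_e : ‖gradient F e‖ ^ 2 = (m : ℝ) ^ 2 := by simpa [he] using hgrad e
  generalize hc : F e = c at hFnorm
  have hc0 : c ≠ 0 := by
    rintro rfl
    obtain rfl : F = fun _ => 0 := by
      ext x
      simpa using hFnorm x
    rw [gradient_fun_const, norm_zero, zero_pow two_ne_zero] at hgrad_e
    exact pow_ne_zero 2 hm0 hgrad_e.symm
  have heven : Even m := by
    by_contra hodd
    have h := hF.map_smul (-1) e
    rw [(Nat.not_even_iff_odd.mp hodd).neg_one_pow, neg_one_smul,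
      hconst (-e) e (by rwa [norm_neg]) he, hc] at h
    exact hc0 (by linarith)
  refine ⟨heven, ?_⟩
  obtain ⟨k, rfl⟩ := even_iff_exists_two_mul.mp heven
  rw [funext hFnorm, (hasGradientAt_norm_pow_two_mul c k e).gradient, norm_smul, he, one_pow,
    mul_one, mul_one, Real.norm_eq_abs, sq_abs, mul_pow] at hgrad_e
  push_cast at hgrad_e hm0
  have hc2 : c ^ 2 = 1 := mul_right_cancel₀ (pow_ne_zero 2 hm0) (by rw [hgrad_e, one_mul])
  rcases sq_eq_one_iff.mp hc2 with rfl | rfl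
  · exact Or.inl fun x => by rw [hFnorm, one_mul]
  · exact Or.inr fun x => by rw [hFnorm, neg_one_mul]
end
end

section
/- Let n ≥ 1, m ≥ 1, let e ∈ ℝⁿ be a unit vector, and define F : ℝⁿ → ℝ by F(x) = Σ_{k=0}^{⌊m/2⌋} (−1)^k · binom(m, 2k) · ⟨x,e⟩^(m−2k) · (‖x‖² − ⟨x,e⟩²)^k. Then ‖∇F(x)‖² = m²‖x‖^(2m−2) for all x ∈ ℝⁿ. -/
open scoped RealInnerProductSpace

noncomputable section

/-- The pair `(A, B)` of real numbers with `(t + ω) ^ m = A + B ω`, where `ω ^ 2 = -q`. -/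
def quadPow (t q : ℝ) : ℕ → ℝ × ℝ
  | 0 => (1, 0)
  | m + 1 => (t * (quadPow t q m).1 - q * (quadPow t q m).2,
      (quadPow t q m).1 + t * (quadPow t q m).2)

lemma quadPow_norm (t q : ℝ) (m : ℕ) :
    (quadPow t q m).1 ^ 2 + q * (quadPow t q m).2 ^ 2 = (t ^ 2 + q) ^ m := by
  induction m with
  | zero => simp [quadPow]
  | succ m ih =>
    rw [pow_succ (t ^ 2 + q), ← ih]
    simp only [quadPow]
    ring

lemma quadPow_complex (t s : ℝ) (m : ℕ) :
    ((s * Complex.I + t : ℂ)) ^ m =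
      (quadPow t (s ^ 2) m).1 + (quadPow t (s ^ 2) m).2 * (s * Complex.I) := by
  induction m with
  | zero => simp [quadPow]
  | succ m ih =>
    rw [pow_succ, ih]
    simp only [quadPow]
    push_cast
    linear_combination (quadPow t (s ^ 2) m).2 * (s : ℂ) ^ 2 * Complex.I_sq

lemma sum_range_two_mul {M : Type*} [AddCommMonoid M] (f : ℕ → M) (N : ℕ) :
    ∑ j ∈ Finset.range (2 * N), f j =
      ∑ k ∈ Finset.range N, (f (2 * k) + f (2 * k + 1)) := by
  induction N with
  | zero => simp
  | succ N ih =>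
    rw [Finset.sum_range_succ, ← ih, mul_add_one, Finset.sum_range_succ, Finset.sum_range_succ,
      add_assoc]

lemma quadPow_fst_eq_sum (t : ℝ) {q : ℝ} (hq : 0 ≤ q) (m : ℕ) :
    (quadPow t q m).1 = ∑ k ∈ Finset.range (m / 2 + 1),
      (-1 : ℝ) ^ k * (m.choose (2 * k) : ℝ) * t ^ (m - 2 * k) * q ^ k := by
  obtain ⟨s, rfl⟩ : ∃ s : ℝ, q = s ^ 2 := ⟨√q, (Real.sq_sqrt hq).symm⟩
  have hre := congrArg Complex.re (quadPow_complex t s m)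
  have hsub : Finset.range (m + 1) ⊆ Finset.range (2 * (m / 2 + 1)) := by
    intro j
    simp only [Finset.mem_range]
    omega
  rw [add_pow, Finset.sum_subset hsub, sum_range_two_mul, Complex.re_sum] at hre
  · have hterm (k : ℕ) : ((s * Complex.I : ℂ) ^ (2 * k) * t ^ (m - 2 * k) * m.choose (2 * k) +
        (s * Complex.I : ℂ) ^ (2 * k + 1) * t ^ (m - (2 * k + 1)) * m.choose (2 * k + 1)).re =
        (-1 : ℝ) ^ k * (m.choose (2 * k) : ℝ) * t ^ (m - 2 * k) * (s ^ 2) ^ k := by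
      have hsq : (s * Complex.I : ℂ) ^ (2 * k) = (((-1) ^ k * (s ^ 2) ^ k : ℝ) : ℂ) := by
        rw [pow_mul, mul_pow, Complex.I_sq]
        push_cast
        rw [← mul_pow]
        ring
      rw [pow_succ, hsq]
      have hcast : ∀ a b c d e : ℝ,
          ((a : ℂ) * b * c + a * (s * Complex.I) * d * e).re = a * b * c := by
        intro a b c d e
        simp
      have := hcast ((-1) ^ k * (s ^ 2) ^ k) (t ^ (m - 2 * k)) (m.choose (2 * k))
        (t ^ (m - (2 * k + 1))) (m.choose (2 * k + 1))
      push_cast at this ⊢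
      rw [this]
      ring
    simp only [hterm] at hre
    rw [hre]
    simp
  · intro j _ hj
    rw [Nat.choose_eq_zero_of_lt (by simpa using hj)]
    simp

lemma HasFDerivAt.quadPow_fst {E : Type*} [NormedAddCommGroup E] [NormedSpace ℝ E]
    {f g : E → ℝ} {f' g' : E →L[ℝ] ℝ} {x : E} (hf : HasFDerivAt f f' x)
    (hg : HasFDerivAt g g' x) (m : ℕ) :
    HasFDerivAt (fun y => (quadPow (f y) (g y) (m + 1)).1)
      ((m + 1 : ℝ) • ((quadPow (f x) (g x) m).1 • f' -
        ((quadPow (f x) (g x) m).2 / 2) • g')) x := by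
  induction m using Nat.twoStepInduction with
  | zero => simpa [quadPow] using hf
  | one =>
    have hrec : (fun y => (quadPow (f y) (g y) (1 + 1)).1) = fun y => f y * f y - g y := by
      ext y
      simp [quadPow]
    rw [hrec]
    refine ((hf.mul hf).sub hg).congr_fderiv ?_
    ext v
    simp [quadPow]
    ring
  | more m ih₀ ih₁ =>
    have hrec : (fun y => (quadPow (f y) (g y) (m + 2 + 1)).1) = fun y =>
        2 * (f y * (quadPow (f y) (g y) (m + 1 + 1)).1) -
          (f y * f y + g y) * (quadPow (f y) (g y) (m + 1)).1 := by
      ext y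
      simp only [quadPow]
      ring
    rw [hrec]
    refine (((hf.mul ih₁).const_mul 2).sub (((hf.mul hf).add hg).mul ih₀)).congr_fderiv ?_
    ext v
    simp [quadPow]
    ring

/-- The polynomial `F(x) = Re(⟨x,e⟩ + i√(‖x‖² - ⟨x,e⟩²))^m` built from a unit vector `e`
satisfies the eiconal equation `‖∇F(x)‖² = m²‖x‖^(2m-2)`. -/
theorem gradient_eq_of_chebyshev_like_sum {n m : ℕ} (hn : 1 ≤ n) (hm : 1 ≤ m)
    (e : EuclideanSpace ℝ (Fin n)) (he : ‖e‖ = 1)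
    (F : EuclideanSpace ℝ (Fin n) → ℝ)
    (hF : ∀ x : EuclideanSpace ℝ (Fin n),
      F x = ∑ k ∈ Finset.range (m / 2 + 1),
        (-1 : ℝ) ^ k * (m.choose (2 * k) : ℝ) * ⟪x, e⟫ ^ (m - 2 * k) *
          (‖x‖ ^ 2 - ⟪x, e⟫ ^ 2) ^ k) :
    ∀ x : EuclideanSpace ℝ (Fin n),
      ‖gradient F x‖ ^ 2 = (m : ℝ) ^ 2 * ‖x‖ ^ (2 * m - 2) := by
  intro x
  obtain ⟨m, rfl⟩ : ∃ l, m = l + 1 := ⟨m - 1, by omega⟩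
  have hq (y : EuclideanSpace ℝ (Fin n)) : 0 ≤ ‖y‖ ^ 2 - ⟪y, e⟫ ^ 2 := by
    have h := abs_real_inner_le_norm y e
    rw [he, mul_one] at h
    exact sub_nonneg.2 (sq_le_sq.2 (by simpa using h))
  have hFA : F = fun y => (quadPow ⟪y, e⟫ (‖y‖ ^ 2 - ⟪y, e⟫ ^ 2) (m + 1)).1 :=
    funext fun y => by rw [hF, quadPow_fst_eq_sum _ (hq y)]
  have ht : HasFDerivAt (fun y : EuclideanSpace ℝ (Fin n) => ⟪y, e⟫) (innerSL ℝ e) x := by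
    simp_rw [real_inner_comm e]
    exact (innerSL ℝ e).hasFDerivAt
  have hr : HasFDerivAt (fun y : EuclideanSpace ℝ (Fin n) => ‖y‖ ^ 2) (2 • innerSL ℝ x) x :=
    (hasStrictFDerivAt_norm_sq x).hasFDerivAt
  have hd := ht.quadPow_fst (hr.sub (ht.pow 2)) m
  set P := quadPow ⟪x, e⟫ (‖x‖ ^ 2 - ⟪x, e⟫ ^ 2) m with hP
  have hgrad : HasGradientAt F ((m + 1 : ℝ) • (P.1 • e - P.2 • (x - ⟪x, e⟫ • e))) x := by
    rw [hasGradientAt_iff_hasFDerivAt, hFA]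
    refine hd.congr_fderiv ?_
    ext v
    simp [← hP]
    left
    ring
  have hnorm : ‖P.1 • e - P.2 • (x - ⟪x, e⟫ • e)‖ ^ 2 =
      P.1 ^ 2 + (‖x‖ ^ 2 - ⟪x, e⟫ ^ 2) * P.2 ^ 2 := by
    have hee : ⟪e, e⟫ = 1 := by rw [real_inner_self_eq_norm_sq, he, one_pow]
    rw [← real_inner_self_eq_norm_sq, ← real_inner_self_eq_norm_sq]
    simp only [inner_sub_left, inner_sub_right, real_inner_smul_left, real_inner_smul_right, hee,
      real_inner_comm x e]
    ring
  rw [hgrad.gradient, norm_smul, mul_pow, hnorm, hP, quadPow_norm, add_sub_cancel, ← pow_mul,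
    Real.norm_eq_abs, sq_abs]
  push_cast
  rfl
end
end

section
/- Define F : ℝ⁵ → ℝ by F(x) = x₅³ + (3/2)·x₅·(x₁² + x₂² − 2x₃² − 2x₄²) + (3√3/2)·x₄·(x₂² − x₁²) + 3√3·x₁x₂x₃. Then ‖∇F(x)‖² = 9‖x‖⁴ for all x ∈ ℝ⁵, and ΔF(x) = 0 for all x ∈ ℝ⁵. -/
noncomputable section

/-- The Laplacian of a function on `ℝⁿ`: the sum of its second partial derivatives. -/
def euclideanLaplacian {n : ℕ} (F : EuclideanSpace ℝ (Fin n) → ℝ)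
    (x : EuclideanSpace ℝ (Fin n)) : ℝ :=
  ∑ i, fderiv ℝ (fun y => fderiv ℝ F y (EuclideanSpace.single i 1)) x (EuclideanSpace.single i 1)

theorem fderiv_apply_eq_of_cubic_along_line {E : Type*} [NormedAddCommGroup E] [NormedSpace ℝ E]
    {G : E → ℝ} {x v : E} (hG : DifferentiableAt ℝ G x) (b c d : ℝ)
    (h : ∀ t : ℝ, G (x + t • v) = G x + t * b + t ^ 2 * c + t ^ 3 * d) :
    fderiv ℝ G x v = b := by
  rw [← hG.lineDeriv_eq_fderiv, lineDeriv, funext h]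
  have h1 : HasDerivAt (fun t : ℝ => t) 1 0 := hasDerivAt_id 0
  have h2 : HasDerivAt (fun t : ℝ => G x + t * b + t ^ 2 * c + t ^ 3 * d) _ 0 :=
    (((h1.mul_const b).const_add (G x)).add ((h1.pow 2).mul_const c)).add ((h1.pow 3).mul_const d)
  rw [h2.deriv]
  simp

theorem EuclideanSpace.gradient_apply {n : ℕ} (F : EuclideanSpace ℝ (Fin n) → ℝ)
    (x : EuclideanSpace ℝ (Fin n)) (i : Fin n) :
    gradient F x i = fderiv ℝ F x (EuclideanSpace.single i 1) := by
  rw [← toDual_gradient, InnerProductSpace.toDual_apply_apply, EuclideanSpace.inner_single_right]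
  simp

/-- The Cartan isoparametric cubic in dimension 5 satisfies `‖∇F(x)‖² = 9‖x‖⁴` and `ΔF = 0`. -/
theorem cartan_cubic_dim5 (F : EuclideanSpace ℝ (Fin 5) → ℝ)
    (hF : ∀ x : EuclideanSpace ℝ (Fin 5),
      F x = (x 4) ^ 3
        + (3 / 2) * (x 4) * ((x 0) ^ 2 + (x 1) ^ 2 - 2 * (x 2) ^ 2 - 2 * (x 3) ^ 2)
        + (3 * Real.sqrt 3 / 2) * (x 3) * ((x 1) ^ 2 - (x 0) ^ 2)
        + 3 * Real.sqrt 3 * (x 0) * (x 1) * (x 2)) :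
    (∀ x : EuclideanSpace ℝ (Fin 5), ‖gradient F x‖ ^ 2 = 9 * ‖x‖ ^ 4) ∧
      (∀ x : EuclideanSpace ℝ (Fin 5), euclideanLaplacian F x = 0) := by
  have hd : Differentiable ℝ F := by
    rw [funext hF]
    fun_prop
  have hp0 (x : EuclideanSpace ℝ (Fin 5)) : fderiv ℝ F x (EuclideanSpace.single 0 1) =
      3 * x 4 * x 0 - 3 * √3 * x 3 * x 0 + 3 * √3 * x 1 * x 2 := by
    refine fderiv_apply_eq_of_cubic_along_line (hd x) _ ((3 / 2) * x 4 - (3 * √3 / 2) * x 3) 0 fun t => ?_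
    simp [hF]
    ring
  have hp1 (x : EuclideanSpace ℝ (Fin 5)) : fderiv ℝ F x (EuclideanSpace.single 1 1) =
      3 * x 4 * x 1 + 3 * √3 * x 3 * x 1 + 3 * √3 * x 0 * x 2 := by
    refine fderiv_apply_eq_of_cubic_along_line (hd x) _ ((3 / 2) * x 4 + (3 * √3 / 2) * x 3) 0 fun t => ?_
    simp [hF]
    ring
  have hp2 (x : EuclideanSpace ℝ (Fin 5)) : fderiv ℝ F x (EuclideanSpace.single 2 1) =
      -6 * x 4 * x 2 + 3 * √3 * x 0 * x 1 := by
    refine fderiv_apply_eq_of_cubic_along_line (hd x) _ (-3 * x 4) 0 fun t => ?_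
    simp [hF]
    ring
  have hp3 (x : EuclideanSpace ℝ (Fin 5)) : fderiv ℝ F x (EuclideanSpace.single 3 1) =
      -6 * x 4 * x 3 + (3 * √3 / 2) * ((x 1) ^ 2 - (x 0) ^ 2) := by
    refine fderiv_apply_eq_of_cubic_along_line (hd x) _ (-3 * x 4) 0 fun t => ?_
    simp [hF]
    ring
  have hp4 (x : EuclideanSpace ℝ (Fin 5)) : fderiv ℝ F x (EuclideanSpace.single 4 1) =
      3 * (x 4) ^ 2 + (3 / 2) * ((x 0) ^ 2 + (x 1) ^ 2 - 2 * (x 2) ^ 2 - 2 * (x 3) ^ 2) := by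
    refine fderiv_apply_eq_of_cubic_along_line (hd x) _ (3 * x 4) 1 fun t => ?_
    simp [hF]
    ring
  refine ⟨fun x => ?_, fun x => ?_⟩
  · have hs : √(3 : ℝ) ^ 2 = 3 := Real.sq_sqrt (by norm_num)
    rw [show ‖x‖ ^ 4 = (‖x‖ ^ 2) ^ 2 by ring, EuclideanSpace.real_norm_sq_eq,
      EuclideanSpace.real_norm_sq_eq]
    simp only [Fin.sum_univ_five, EuclideanSpace.gradient_apply, hp0, hp1, hp2, hp3, hp4]
    ring_nf
    simp only [hs]
    ring
  · have hq0 : fderiv ℝ (fun y => fderiv ℝ F y (EuclideanSpace.single 0 1)) x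
        (EuclideanSpace.single 0 1) = 3 * x 4 - 3 * √3 * x 3 := by
      simp only [hp0]
      refine fderiv_apply_eq_of_cubic_along_line (by fun_prop) _ 0 0 fun t => ?_
      simp
      ring
    have hq1 : fderiv ℝ (fun y => fderiv ℝ F y (EuclideanSpace.single 1 1)) x
        (EuclideanSpace.single 1 1) = 3 * x 4 + 3 * √3 * x 3 := by
      simp only [hp1]
      refine fderiv_apply_eq_of_cubic_along_line (by fun_prop) _ 0 0 fun t => ?_
      simp
      ring
    have hq2 : fderiv ℝ (fun y => fderiv ℝ F y (EuclideanSpace.single 2 1)) x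
        (EuclideanSpace.single 2 1) = -6 * x 4 := by
      simp only [hp2]
      refine fderiv_apply_eq_of_cubic_along_line (by fun_prop) _ 0 0 fun t => ?_
      simp
      ring
    have hq3 : fderiv ℝ (fun y => fderiv ℝ F y (EuclideanSpace.single 3 1)) x
        (EuclideanSpace.single 3 1) = -6 * x 4 := by
      simp only [hp3]
      refine fderiv_apply_eq_of_cubic_along_line (by fun_prop) _ 0 0 fun t => ?_
      simp
      ring
    have hq4 : fderiv ℝ (fun y => fderiv ℝ F y (EuclideanSpace.single 4 1)) x
        (EuclideanSpace.single 4 1) = 6 * x 4 := by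
      simp only [hp4]
      refine fderiv_apply_eq_of_cubic_along_line (by fun_prop) _ 3 0 fun t => ?_
      simp
      ring
    simp only [euclideanLaplacian, Fin.sum_univ_five, hq0, hq1, hq2, hq3, hq4]
    ring
end
end

section
/- The Cartan cubic F = x₅³ + (3/2)·x₅·(x₁² + x₂² − 2x₃² − 2x₄²) + (3√3/2)·x₄·(x₂² − x₁²) + 3√3·x₁x₂x₃, viewed as a multivariate polynomial in ℝ[x₁,…,x₅], is irreducible. -/
open MvPolynomial

noncomputable section

/-- The Cartan cubic in `ℝ[x₁,…,x₅]` (variables `X 0, …, X 4`). -/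
def cartanCubic : MvPolynomial (Fin 5) ℝ :=
  X 4 ^ 3
    + C (3 / 2 : ℝ) * X 4 * (X 0 ^ 2 + X 1 ^ 2 - C 2 * X 2 ^ 2 - C 2 * X 3 ^ 2)
    + C (3 * Real.sqrt 3 / 2) * X 3 * (X 1 ^ 2 - X 0 ^ 2)
    + C (3 * Real.sqrt 3) * X 0 * X 1 * X 2

/-- The coefficient of `X 4` in the Cartan cubic, as a polynomial in the other variables. -/
def cartanCubicLinearCoeff : MvPolynomial (Fin 4) ℝ :=
  C (3 / 2 : ℝ) * (X 0 ^ 2 + X 1 ^ 2 - C 2 * X 2 ^ 2 - C 2 * X 3 ^ 2)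

/-- The part of the Cartan cubic that is free of `X 4`. -/
def cartanCubicConstantCoeff : MvPolynomial (Fin 4) ℝ :=
  C (3 * Real.sqrt 3 / 2) * X 3 * (X 1 ^ 2 - X 0 ^ 2) + C (3 * Real.sqrt 3) * X 0 * X 1 * X 2

/-- Polynomials in `n + 1` variables are polynomials in the last variable over the polynomials in
the first `n` variables. -/
def lastVariableEquiv (R : Type*) [CommSemiring R] (n : ℕ) :
    MvPolynomial (Fin (n + 1)) R ≃ₐ[R] Polynomial (MvPolynomial (Fin n) R) :=
  (renameEquiv R finSuccEquivLast).trans (optionEquivLeft R (Fin n))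

theorem lastVariableEquiv_X_last (R : Type*) [CommSemiring R] (n : ℕ) :
    lastVariableEquiv R n (X (Fin.last n)) = Polynomial.X := by
  simp [lastVariableEquiv, optionEquivLeft_X_none]

theorem lastVariableEquiv_X_castSucc {R : Type*} [CommSemiring R] {n : ℕ} (j : Fin n) :
    lastVariableEquiv R n (X j.castSucc) = Polynomial.C (X j) := by
  simp [lastVariableEquiv, optionEquivLeft_X_some]

theorem lastVariableEquiv_C {R : Type*} [CommSemiring R] (n : ℕ) (a : R) :
    lastVariableEquiv R n (C a) = Polynomial.C (C a) := by
  simp [lastVariableEquiv, optionEquivLeft_C]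

theorem lastVariableEquiv_cartanCubic :
    lastVariableEquiv ℝ 4 cartanCubic = Polynomial.X ^ 3 +
      (Polynomial.C cartanCubicLinearCoeff * Polynomial.X +
        Polynomial.C cartanCubicConstantCoeff) := by
  have h0 : lastVariableEquiv ℝ 4 (X 0) = _ := lastVariableEquiv_X_castSucc 0
  have h1 : lastVariableEquiv ℝ 4 (X 1) = _ := lastVariableEquiv_X_castSucc 1
  have h2 : lastVariableEquiv ℝ 4 (X 2) = _ := lastVariableEquiv_X_castSucc 2
  have h3 : lastVariableEquiv ℝ 4 (X 3) = _ := lastVariableEquiv_X_castSucc 3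
  have h4 : lastVariableEquiv ℝ 4 (X 4) = _ := lastVariableEquiv_X_last ℝ 4
  simp only [cartanCubic, cartanCubicLinearCoeff, cartanCubicConstantCoeff, map_add, map_sub,
    map_mul, map_pow, h0, h1, h2, h3, h4, lastVariableEquiv_C]
  ring

/-- A univariate polynomial solution of `(p - s) (p² + s p + (3 / 2) t²) = 0`, where `s² = 3`,
is the constant `s`, since the quadratic factor has no real root at `t = 1`. -/
theorem eq_C_of_mul_quadratic_eq_zero {s : ℝ} (hs : s ^ 2 = 3) {p : Polynomial ℝ}
    (h : (p - Polynomial.C s) *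
      (p ^ 2 + Polynomial.C s * p + Polynomial.C (3 / 2) * Polynomial.X ^ 2) = 0) :
    p = Polynomial.C s := by
  refine sub_eq_zero.mp ((mul_eq_zero.mp h).resolve_right fun hq => ?_)
  have h1 := congrArg (Polynomial.eval 1) hq
  simp only [Polynomial.eval_add, Polynomial.eval_mul, Polynomial.eval_pow, Polynomial.eval_C,
    Polynomial.eval_X, Polynomial.eval_zero] at h1
  nlinarith [sq_nonneg (p.eval 1 + s / 2)]

theorem eval_aeval_polynomial {σ R : Type*} [CommSemiring R] (r : MvPolynomial σ R)
    (v : σ → Polynomial R) (a : R) :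
    (aeval v r).eval a = eval (fun i => (v i).eval a) r := by
  induction r using MvPolynomial.induction_on with
  | C b => simp
  | add p q hp hq => simp [hp, hq]
  | mul_X p i hp => simp [hp]

/-- The Cartan cubic has no root in its last variable: on the line `(0, t, 0, 1)` such a root would
be constantly `-√3`, on the line `(t, 0, 0, 1)` constantly `√3`, and the two lines meet. -/
theorem cartanCubic_no_root (r : MvPolynomial (Fin 4) ℝ) :
    r ^ 3 + (cartanCubicLinearCoeff * r + cartanCubicConstantCoeff) ≠ 0 := by
  intro h
  have hs : √(3 : ℝ) ^ 2 = 3 := Real.sq_sqrt (by norm_num)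
  have hC : (Polynomial.C √(3 : ℝ)) ^ 2 = Polynomial.C 3 := by rw [← Polynomial.C_pow, hs]
  have hcoeff : (Polynomial.C (3 * √3 / 2) : Polynomial ℝ) =
      Polynomial.C (3 / 2) * Polynomial.C √3 := by rw [← Polynomial.C_mul]; ring_nf
  have hthree : (Polynomial.C (3 / 2) : Polynomial ℝ) * Polynomial.C 2 = Polynomial.C 3 := by
    rw [← Polynomial.C_mul]; norm_num
  let v : Fin 4 → Polynomial ℝ := ![0, Polynomial.X, 0, 1]
  let w : Fin 4 → Polynomial ℝ := ![Polynomial.X, 0, 0, 1]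
  have hv := congrArg (aeval v) h
  have hw := congrArg (aeval w) h
  simp [cartanCubicLinearCoeff, cartanCubicConstantCoeff, v, -map_div₀] at hv
  simp [cartanCubicLinearCoeff, cartanCubicConstantCoeff, w, -map_div₀] at hw
  have hrv : aeval v r = Polynomial.C (-√3) :=
    eq_C_of_mul_quadratic_eq_zero (by rw [neg_sq, hs]) <| by
      rw [Polynomial.C_neg]
      linear_combination hv - aeval v r * (hC - hthree) - Polynomial.X ^ 2 * hcoeff
  have hrw : aeval w r = Polynomial.C √3 :=
    eq_C_of_mul_quadratic_eq_zero hs <| by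
      linear_combination hw - aeval w r * (hC - hthree) + Polynomial.X ^ 2 * hcoeff
  have hvw : (fun i => (v i).eval 0) = fun i => (w i).eval 0 := by
    funext i
    fin_cases i <;> simp [v, w]
  have hmeet : (aeval v r).eval 0 = (aeval w r).eval 0 := by
    rw [eval_aeval_polynomial, eval_aeval_polynomial, hvw]
  rw [hrv, hrw, Polynomial.eval_C, Polynomial.eval_C] at hmeet
  have : 0 < √(3 : ℝ) := by positivity
  linarith

/-- The Cartan cubic is irreducible in `ℝ[x₁,…,x₅]`. -/
theorem cartanCubic_irreducible : Irreducible cartanCubic := by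
  have hdeg : (Polynomial.C cartanCubicLinearCoeff * Polynomial.X +
      Polynomial.C cartanCubicConstantCoeff).degree < ((3 : ℕ) : WithBot ℕ) :=
    Polynomial.degree_linear_lt.trans (by norm_num)
  have hmonic := Polynomial.monic_X_pow_add hdeg
  have hnat : (Polynomial.X ^ 3 + (Polynomial.C cartanCubicLinearCoeff * Polynomial.X +
      Polynomial.C cartanCubicConstantCoeff)).natDegree = 3 := by
    compute_degree!
  rw [← MulEquiv.irreducible_iff (lastVariableEquiv ℝ 4), lastVariableEquiv_cartanCubic,
    hmonic.irreducible_iff_roots_eq_zero_of_degree_le_three (by lia) (by lia),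
    Multiset.eq_zero_iff_forall_notMem]
  intro r hr
  exact cartanCubic_no_root r (by simpa [Polynomial.IsRoot] using Polynomial.isRoot_of_mem_roots hr)
end
end

section
/- Let n ≥ 2 and let F : ℝⁿ → ℝ be a homogeneous polynomial of degree 3 satisfying ‖∇F(x)‖² = 9‖x‖⁴ for all x ∈ ℝⁿ. Then either F is a Cartan–Münzner polynomial of degree 3 on ℝⁿ, or there exist a unit vector e ∈ ℝⁿ and a sign ε ∈ {1,−1} such that F(x) = ε·(4⟨x,e⟩³ − 3⟨x,e⟩‖x‖²) for all x ∈ ℝⁿ. -/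
open scoped RealInnerProductSpace

noncomputable section

/-- The operator `z ↦ ⟪x, z⟫ y` has trace `⟪x, y⟫`. -/
theorem trace_innerₛₗ_smulRight {E : Type*} [NormedAddCommGroup E] [InnerProductSpace ℝ E]
    [FiniteDimensional ℝ E] (x y : E) :
    LinearMap.trace ℝ E ((innerₛₗ ℝ x).smulRight y) = ⟪x, y⟫ := by
  rw [LinearMap.trace_smulRight, innerₛₗ_apply_apply]

section EiconalMul

variable {E : Type*} [NormedAddCommGroup E] [InnerProductSpace ℝ E]

/-- A commutative bilinear multiplication `L` on a Euclidean space, with symmetric multiplication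
operators, satisfying `x(xx) = ‖x‖² x`. -/
structure IsEiconalMul (L : E →ₗ[ℝ] E →ₗ[ℝ] E) : Prop where
  comm : ∀ x y, L x y = L y x
  symm : ∀ x y z, ⟪L x y, z⟫ = ⟪y, L x z⟫
  cube : ∀ x, L x (L x x) = ‖x‖ ^ 2 • x

namespace IsEiconalMul

variable {L : E →ₗ[ℝ] E →ₗ[ℝ] E}

theorem polarized (h : IsEiconalMul L) (x y z : E) :
    L (L x y) z + L x (L y z) + L y (L x z) = ⟪x, y⟫ • z + ⟪y, z⟫ • x + ⟪x, z⟫ • y := by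
  have h1 := h.cube (x + y + z)
  have h2 := h.cube (x + y)
  have h3 := h.cube (y + z)
  have h4 := h.cube (x + z)
  have hx := h.cube x
  have hy := h.cube y
  have hz := h.cube z
  simp only [← real_inner_self_eq_norm_sq, map_add, LinearMap.add_apply, inner_add_left,
    inner_add_right] at h1 h2 h3 h4 hx hy hz
  simp only [h.comm y x, h.comm z x, h.comm z y, real_inner_comm x y, real_inner_comm x z,
    real_inner_comm y z] at h1 h2 h3 h4
  rw [h.comm (L x y) z]
  linear_combination (norm := module) (1 / 2 : ℝ) • (h1 - h2 - h3 - h4 + hx + hy + hz)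

theorem inner_sq_sq (h : IsEiconalMul L) (x : E) : ⟪L x x, L x x⟫ = (‖x‖ ^ 2) ^ 2 := by
  rw [h.symm, h.cube, inner_smul_right, real_inner_self_eq_norm_sq]
  ring

/-- If `e` acts as the reflection fixing the line of `e`, the cubic form is determined. -/
theorem inner_sq_self_of_reflection (h : IsEiconalMul L) {e : E}
    (hL : ∀ x, L e x = (2 * ⟪e, x⟫) • e - x) (x : E) :
    ⟪L x x, x⟫ = 4 * ⟪x, e⟫ ^ 3 - 3 * ⟪x, e⟫ * ‖x‖ ^ 2 := by
  have h1 := h.polarized x x e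
  have h2 : ⟪e, L x x⟫ = 2 * ⟪x, e⟫ ^ 2 - ‖x‖ ^ 2 := by
    rw [← h.symm, h.comm, hL, inner_sub_left, inner_smul_left, real_inner_self_eq_norm_sq,
      real_inner_comm e x]
    simp
    ring
  rw [h.comm x e, h.comm (L x x) e, hL, hL, h2] at h1
  have h3 := congrArg (fun v => ⟪v, x⟫) h1
  simp only [map_sub, map_smul, h.comm x e, hL, inner_add_left, inner_sub_left,
    real_inner_smul_left, real_inner_self_eq_norm_sq, real_inner_comm x e] at h3
  linear_combination (-1 / 3 : ℝ) * h3

theorem exists_idempotent [Nontrivial E] (h : IsEiconalMul L) :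
    ∃ e : E, ‖e‖ = 1 ∧ L e e = e := by
  obtain ⟨x, hx⟩ := exists_norm_eq E zero_le_one
  set b := L x x with hb
  have hxx : ⟪x, x⟫ = 1 := by rw [real_inner_self_eq_norm_sq, hx, one_pow]
  have hbb : ⟪b, b⟫ = 1 := by rw [h.inner_sq_sq, hx]; norm_num
  have hxb : L x b = x := by rw [hb, h.cube, hx, one_pow, one_smul]
  have hbx : L b x = x := by rw [h.comm, hxb]
  set c := ⟪x, b⟫ with hc
  have hbxc : ⟪b, x⟫ = c := real_inner_comm _ _
  have hLbb : L b b = (2 * c) • x - b := by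
    have h1 := h.polarized x x b
    rw [hxb, hxx, ← hc, ← hb] at h1
    linear_combination (norm := module) h1
  have hbn : ‖b‖ = 1 := by
    rw [real_inner_self_eq_norm_sq] at hbb
    nlinarith [norm_nonneg b]
  have hcabs : |c| ≤ 1 := by
    have := abs_real_inner_le_norm x b
    rwa [hx, hbn, one_mul] at this
  obtain ⟨hc1, hc2⟩ := abs_le.mp hcabs
  by_cases hcm : c = -1
  · have hbe : b = -x := by
      rw [← sub_eq_zero, sub_neg_eq_add, ← inner_self_eq_zero (𝕜 := ℝ)]
      rw [inner_add_left, inner_add_right, inner_add_right, hxx, hbb, hbxc, ← hc, hcm]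
      norm_num
    exact ⟨-x, by rw [norm_neg, hx], by simp [← hb, hbe]⟩
  obtain ⟨k, hk, hkc⟩ : ∃ k ∈ Set.Icc (1 / 2 : ℝ) 1, 4 * k ^ 3 - 3 * k = c := by
    apply intermediate_value_Icc (f := fun k : ℝ => 4 * k ^ 3 - 3 * k) (by norm_num)
      (by fun_prop)
    constructor <;> norm_num <;> assumption
  have hd : 4 * k ^ 2 - 1 ≠ 0 := by
    intro h0
    have : k = 1 / 2 := by nlinarith [hk.1]
    apply hcm
    rw [← hkc, this]
    norm_num
  refine ⟨(4 * k ^ 2 - 1)⁻¹ • ((2 * k) • x + b), ?_, ?_⟩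
  · have h1 : ‖(2 * k) • x + b‖ ^ 2 = (4 * k ^ 2 - 1) ^ 2 := by
      rw [← real_inner_self_eq_norm_sq]
      simp only [inner_add_left, inner_add_right, real_inner_smul_left, real_inner_smul_right,
        hxx, hbb, hbxc, ← hc]
      rw [← hkc]
      ring
    have h2 : ‖(2 * k) • x + b‖ = |4 * k ^ 2 - 1| := by
      rw [← abs_norm]
      exact (sq_eq_sq_iff_abs_eq_abs _ _).mp h1
    rw [norm_smul, h2, norm_inv, Real.norm_eq_abs, inv_mul_cancel₀ (abs_ne_zero.mpr hd)]
  · have h1 : L ((2 * k) • x + b) ((2 * k) • x + b) = (4 * k ^ 2 - 1) • ((2 * k) • x + b) := by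
      simp only [map_add, map_smul, LinearMap.add_apply, LinearMap.smul_apply, hxb, hbx, hLbb,
        ← hb]
      rw [← hkc]
      module
    rw [map_smul, map_smul, LinearMap.smul_apply, h1, smul_smul (4 * k ^ 2 - 1)⁻¹ (4 * k ^ 2 - 1),
      inv_mul_cancel₀ hd, one_smul]

theorem mul_mul_add (h : IsEiconalMul L) (x y : E) :
    L (L x y) + L x ∘ₗ L y + L y ∘ₗ L x = ⟪x, y⟫ • LinearMap.id +
      (innerₛₗ ℝ y).smulRight x + (innerₛₗ ℝ x).smulRight y := by
  ext z
  simpa using h.polarized x y z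

theorem idempotent_mul_mul (h : IsEiconalMul L) {e : E} (he : ‖e‖ = 1) (hee : L e e = e) (x : E) :
    L e (L e x) = (1 / 2 : ℝ) • (x - L e x) + ⟪e, x⟫ • e := by
  have h1 := h.polarized e e x
  rw [hee, real_inner_self_eq_norm_sq, he] at h1
  linear_combination (norm := module) (1 / 2 : ℝ) • h1

variable [FiniteDimensional ℝ E]

theorem trace_mul (h : IsEiconalMul L) (x y : E) :
    LinearMap.trace ℝ E (L (L x y)) + 2 * LinearMap.trace ℝ E (L x ∘ₗ L y) =
      (Module.finrank ℝ E + 2) * ⟪x, y⟫ := by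
  have h1 := congrArg (LinearMap.trace ℝ E) (h.mul_mul_add x y)
  simp only [map_add, map_smul, trace_innerₛₗ_smulRight, LinearMap.trace_id,
    LinearMap.trace_comp_comm' (L x) (L y), smul_eq_mul, real_inner_comm x y] at h1
  linear_combination h1

theorem trace_comp_swap (h : IsEiconalMul L) (x y z : E) :
    LinearMap.trace ℝ E (L y ∘ₗ L x ∘ₗ L z) = LinearMap.trace ℝ E (L x ∘ₗ L y ∘ₗ L z) := by
  rw [← LinearMap.comp_assoc, LinearMap.trace_comp_comm',
    LinearMap.trace_eq_sum_inner _ (stdOrthonormalBasis ℝ E),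
    LinearMap.trace_eq_sum_inner _ (stdOrthonormalBasis ℝ E)]
  refine Finset.sum_congr rfl fun i _ => ?_
  simp only [LinearMap.comp_apply]
  rw [← h.symm, ← h.symm, ← h.symm, real_inner_comm]

theorem trace_mul_mul (h : IsEiconalMul L) (x y z : E) :
    LinearMap.trace ℝ E (L (L (L x y) z)) = ⟪y, z⟫ * LinearMap.trace ℝ E (L x) +
      ⟪x, z⟫ * LinearMap.trace ℝ E (L y) - ⟪x, y⟫ * LinearMap.trace ℝ E (L z) := by
  have key (x y z : E) : LinearMap.trace ℝ E (L (L x y) ∘ₗ L z) +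
      2 * LinearMap.trace ℝ E (L x ∘ₗ L y ∘ₗ L z) =
      ⟪x, y⟫ * LinearMap.trace ℝ E (L z) + 2 * ⟪L x y, z⟫ := by
    have h1 := congrArg (fun f => LinearMap.trace ℝ E (f ∘ₗ L z)) (h.mul_mul_add x y)
    have h2 (u v : E) : (innerₛₗ ℝ u).smulRight v ∘ₗ L z = (innerₛₗ ℝ (L z u)).smulRight v := by
      ext w
      simp [h.symm]
    simp only [LinearMap.add_comp, map_add, LinearMap.smul_comp, map_smul, h2,
      trace_innerₛₗ_smulRight, LinearMap.id_comp, LinearMap.comp_assoc, smul_eq_mul,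
      h.trace_comp_swap x y z] at h1
    have h3 : ⟪L z y, x⟫ = ⟪L x y, z⟫ := by rw [h.comm z y, h.symm, h.comm y x, real_inner_comm]
    have h4 : ⟪L z x, y⟫ = ⟪L x y, z⟫ := by rw [h.comm z x, h.symm, real_inner_comm]
    rw [h3, h4] at h1
    linear_combination h1
  have k1 := key x y z
  have k2 := key y z x
  have k3 := key x z y
  have s2 : LinearMap.trace ℝ E (L y ∘ₗ L z ∘ₗ L x) = LinearMap.trace ℝ E (L x ∘ₗ L y ∘ₗ L z) :=
    LinearMap.trace_comp_cycle (L z) (L y) (L x) |>.trans <|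
      LinearMap.trace_comp_cycle (L x) (L z) (L y)
  have s3 : LinearMap.trace ℝ E (L x ∘ₗ L z ∘ₗ L y) = LinearMap.trace ℝ E (L x ∘ₗ L y ∘ₗ L z) := by
    rw [← h.trace_comp_swap, LinearMap.trace_comp_cycle]
  have i2 : ⟪L y z, x⟫ = ⟪L x y, z⟫ := by rw [h.symm, h.comm y x, real_inner_comm]
  have i3 : ⟪L x z, y⟫ = ⟪L x y, z⟫ := by rw [h.symm, real_inner_comm]
  have p := congrArg (fun v => LinearMap.trace ℝ E (L v)) (h.polarized x y z)
  simp only [map_add, map_smul, smul_eq_mul] at p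
  have t1 := h.trace_mul (L x y) z
  have t2 := h.trace_mul (L y z) x
  have t3 := h.trace_mul (L x z) y
  rw [h.comm _ x] at t2
  rw [h.comm _ y] at t3
  rw [s2, i2] at k2
  rw [s3, i3] at k3
  rw [i2] at t2
  rw [i3] at t3
  linear_combination (1 / 3 : ℝ) * p + (2 / 3 : ℝ) * (t1 - 2 * k1) - (1 / 3 : ℝ) * (t2 - 2 * k2)
    - (1 / 3 : ℝ) * (t3 - 2 * k3)

theorem trace_smul_add (h : IsEiconalMul L) {a : E} {r : ℝ} (hr : r ≠ 0)
    (htr : ∀ z, LinearMap.trace ℝ E (L z) = r * ⟪a, z⟫) (x y : E) :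
    L a (L x y) = ⟪a, x⟫ • y + ⟪a, y⟫ • x - ⟪x, y⟫ • a := by
  refine ext_inner_right ℝ fun z => ?_
  have h1 := h.trace_mul_mul x y z
  rw [htr, htr, htr, htr, h.comm, ← h.symm, h.comm z a, h.symm, ← real_inner_comm] at h1
  simp only [inner_add_left, inner_sub_left, real_inner_smul_left]
  refine mul_left_cancel₀ hr ?_
  linear_combination h1

/-- If the trace form does not vanish, there is an idempotent acting as a reflection. -/
theorem exists_reflection_of_trace_ne_zero (h : IsEiconalMul L)
    {z : E} (hz : LinearMap.trace ℝ E (L z) ≠ 0) :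
    ∃ e : E, ‖e‖ = 1 ∧ ∀ x, L e x = (2 * ⟪e, x⟫) • e - x := by
  obtain ⟨a, r, ha, hr, htr⟩ : ∃ (a : E) (r : ℝ), ⟪a, a⟫ = 1 ∧ r ≠ 0 ∧
      ∀ z, LinearMap.trace ℝ E (L z) = r * ⟪a, z⟫ := by
    let τ : E →L[ℝ] ℝ := (LinearMap.trace ℝ E ∘ₗ L).toContinuousLinearMap
    let d := (InnerProductSpace.toDual ℝ E).symm τ
    have hd (z : E) : LinearMap.trace ℝ E (L z) = ⟪d, z⟫ :=
      (InnerProductSpace.toDual_symm_apply (x := z) (y := τ)).symm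
    have hd0 : ‖d‖ ≠ 0 := by
      rw [norm_ne_zero_iff]
      intro h0
      rw [hd, h0, inner_zero_left] at hz
      exact hz rfl
    refine ⟨‖d‖⁻¹ • d, ‖d‖, ?_, hd0, fun z => ?_⟩
    · rw [real_inner_smul_left, real_inner_smul_right, real_inner_self_eq_norm_sq]
      field_simp
    · rw [hd, real_inner_smul_left, mul_inv_cancel_left₀ hd0]
  have hmul := h.trace_smul_add hr htr
  set b := L a a with hb
  set c := ⟪a, b⟫ with hc
  have hba : ⟪b, a⟫ = c := real_inner_comm _ _
  have hab : L a b = a := by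
    rw [hb, h.cube, ← real_inner_self_eq_norm_sq, ha, one_smul]
  have hbb : ⟪b, b⟫ = 1 := by
    rw [h.inner_sq_sq, ← real_inner_self_eq_norm_sq, ha, one_pow]
  have haa (x : E) : L a (L a x) = x := by
    rw [hmul a x, ha, one_smul, add_sub_cancel_right]
  have hLb (x : E) : L b x = (2 * ⟪a, x⟫) • a - x := by
    have h1 := h.polarized a a x
    rw [haa, ← hb, ha] at h1
    linear_combination (norm := module) h1
  have hbx (x : E) : c • L a x = ⟪a, x⟫ • a + ⟪b, x⟫ • b - x := by
    have h1 := h.polarized b b x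
    simp only [hLb, map_sub, map_smul, LinearMap.sub_apply, LinearMap.smul_apply, ← hc, hbb,
      inner_sub_right, real_inner_smul_right, ha] at h1
    linear_combination (norm := module) (1 / 2 : ℝ) • h1
  have hcr : c * r = 2 - Module.finrank ℝ E := by
    have h1 : c • L a = (innerₛₗ ℝ a).smulRight a + (innerₛₗ ℝ b).smulRight b - LinearMap.id := by
      ext x
      simpa using hbx x
    have h2 := congrArg (LinearMap.trace ℝ E) h1
    simp only [map_sub, map_add, map_smul, trace_innerₛₗ_smulRight, LinearMap.trace_id, htr, ha,
      hbb, smul_eq_mul] at h2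
    linear_combination h2
  have hrc : r = (2 - Module.finrank ℝ E) * c := by
    have h1 : L a ∘ₗ L b = (2 : ℝ) • (innerₛₗ ℝ a).smulRight b - L a := by
      ext x
      simp [hLb, ← hb, smul_smul]
    have h2 := h.trace_mul a b
    rw [h1, hab, map_sub, map_smul, trace_innerₛₗ_smulRight, htr, ha, ← hc, smul_eq_mul] at h2
    linear_combination -h2
  have hc1 : c * c = 1 := by
    refine mul_right_cancel₀ hr ?_
    rw [mul_assoc, hcr, mul_comm c, ← hrc, one_mul]
  have hbca : b = c • a := by
    rw [← sub_eq_zero, ← inner_self_eq_zero (𝕜 := ℝ)]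
    simp only [inner_sub_left, inner_sub_right, real_inner_smul_left, real_inner_smul_right, hbb,
      ha, hba, ← hc]
    linear_combination -hc1
  have hcc : ‖c • a‖ ^ 2 = 1 := by
    rw [← real_inner_self_eq_norm_sq, real_inner_smul_left, real_inner_smul_right, ha, mul_one, hc1]
  refine ⟨c • a, by nlinarith [norm_nonneg (c • a)], fun x => ?_⟩
  rw [map_smul, LinearMap.smul_apply, hbx, hbca, real_inner_smul_left]
  have hca : (c * c) • a = a := by rw [hc1, one_smul]
  linear_combination (norm := module) (-⟪a, x⟫) • hca

/-- If the trace form vanishes, the dimension is `2` modulo `3`. -/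
theorem exists_finrank_eq (h : IsEiconalMul L) (htr : ∀ z, LinearMap.trace ℝ E (L z) = 0) {e : E}
    (he : ‖e‖ = 1) (hee : L e e = e) : ∃ p : ℕ, Module.finrank ℝ E + 1 = 3 * p := by
  set f : E →ₗ[ℝ] E :=
    (1 / 3 : ℝ) • (LinearMap.id - (2 : ℝ) • L e + (innerₛₗ ℝ e).smulRight e) with hf
  have hid : IsIdempotentElem f := by
    have hin (x : E) : ⟪e, L e x⟫ = ⟪e, x⟫ := by rw [← h.symm, hee]
    have he1 : ⟪e, e⟫ = 1 := by rw [real_inner_self_eq_norm_sq, he, one_pow]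
    ext x
    simp only [hf, Module.End.mul_apply, LinearMap.smul_apply, LinearMap.add_apply,
      LinearMap.sub_apply, LinearMap.id_apply, LinearMap.smulRight_apply, innerₛₗ_apply_apply,
      map_smul, map_add, map_sub, h.idempotent_mul_mul he hee, hee, hin, he1]
    module
  have h1 := (LinearMap.IsIdempotentElem.isProj_range f hid).trace
  refine ⟨Module.finrank ℝ (LinearMap.range f), ?_⟩
  rw [hf, map_smul, map_add, map_sub, map_smul, trace_innerₛₗ_smulRight, htr, LinearMap.trace_id,
    real_inner_self_eq_norm_sq, he, ← hf] at h1
  have h2 : (Module.finrank ℝ E + 1 : ℝ) = 3 * Module.finrank ℝ (LinearMap.range f) := by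
    rw [← h1, smul_eq_mul, smul_zero]
    ring
  exact_mod_cast h2

/-- In dimension two, a traceless idempotent acts as a reflection. -/
theorem idempotent_mul_of_finrank_eq_two (h : IsEiconalMul L) (hE : Module.finrank ℝ E = 2) {e : E}
    (he : ‖e‖ = 1) (hee : L e e = e) (htr : LinearMap.trace ℝ E (L e) = 0) (x : E) :
    L e x = (2 * ⟪e, x⟫) • e - x := by
  set f : E →ₗ[ℝ] E :=
    (2 / 3 : ℝ) • (LinearMap.id + L e - (2 : ℝ) • (innerₛₗ ℝ e).smulRight e) with hf
  have hid : IsIdempotentElem f := by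
    have hin (x : E) : ⟪e, L e x⟫ = ⟪e, x⟫ := by rw [← h.symm, hee]
    have he1 : ⟪e, e⟫ = 1 := by rw [real_inner_self_eq_norm_sq, he, one_pow]
    ext x
    simp only [hf, Module.End.mul_apply, LinearMap.smul_apply, LinearMap.add_apply,
      LinearMap.sub_apply, LinearMap.id_apply, LinearMap.smulRight_apply, innerₛₗ_apply_apply,
      map_smul, map_add, map_sub, h.idempotent_mul_mul he hee, hee, hin, he1]
    module
  have h0 : f = 0 := by
    apply LinearMap.IsIdempotentElem.eq_zero_of_trace_eq_zero hid
    rw [hf, map_smul, map_sub, map_add, map_smul, trace_innerₛₗ_smulRight, htr, LinearMap.trace_id,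
      real_inner_self_eq_norm_sq, he, hE]
    norm_num
  have h1 : f x = 0 := by rw [h0, LinearMap.zero_apply]
  simp only [hf, LinearMap.smul_apply, LinearMap.add_apply, LinearMap.sub_apply,
    LinearMap.id_apply, LinearMap.smulRight_apply, innerₛₗ_apply_apply] at h1
  linear_combination (norm := module) (3 / 2 : ℝ) • h1

theorem traceless_or_reflection (h : IsEiconalMul L) (hE : 2 ≤ Module.finrank ℝ E) :
    ((∀ z, LinearMap.trace ℝ E (L z) = 0) ∧ ∃ m : ℕ, 0 < m ∧ Module.finrank ℝ E = 3 * m + 2) ∨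
      ∃ e : E, ‖e‖ = 1 ∧ ∀ x, L e x = (2 * ⟪e, x⟫) • e - x := by
  have : Nontrivial E := Module.nontrivial_of_finrank_pos (R := ℝ) (by lia)
  by_cases htr : ∀ z, LinearMap.trace ℝ E (L z) = 0
  · obtain ⟨e, he, hee⟩ := h.exists_idempotent
    by_cases h2 : Module.finrank ℝ E = 2
    · exact Or.inr ⟨e, he, h.idempotent_mul_of_finrank_eq_two h2 he hee (htr e)⟩
    · obtain ⟨p, hp⟩ := h.exists_finrank_eq htr he hee
      exact Or.inl ⟨htr, p - 1, by lia, by lia⟩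
  · push Not at htr
    obtain ⟨z, hz⟩ := htr
    exact Or.inr (h.exists_reflection_of_trace_ne_zero hz)

end IsEiconalMul
end EiconalMul

section CubicForm

theorem IsEiconalMul.of_norm_sq {E : Type*} [NormedAddCommGroup E] [InnerProductSpace ℝ E]
    {L : E →ₗ[ℝ] E →ₗ[ℝ] E} (hcomm : ∀ x y, L x y = L y x)
    (hsymm : ∀ x y z, ⟪L x y, z⟫ = ⟪y, L x z⟫) (hnorm : ∀ x, ‖L x x‖ ^ 2 = ‖x‖ ^ 4) :
    IsEiconalMul L := by
  refine ⟨hcomm, hsymm, fun x => ext_inner_right ℝ fun y => ?_⟩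
  have key (t : ℝ) := hnorm (x + t • y)
  have h4 (v : E) : ‖v‖ ^ 4 = ⟪v, v⟫ ^ 2 := by rw [real_inner_self_eq_norm_sq]; ring
  simp only [h4, ← real_inner_self_eq_norm_sq, map_add, map_smul, LinearMap.add_apply,
    LinearMap.smul_apply, inner_add_left, inner_add_right, real_inner_smul_left,
    real_inner_smul_right, hcomm y x, real_inner_comm x y, real_inner_comm (L x x) (L x y),
    real_inner_comm (L x x) (L y y), real_inner_comm (L x y) (L y y)] at key
  rw [hsymm, real_inner_smul_left, ← real_inner_self_eq_norm_sq]
  linear_combination (1 / 6 : ℝ) * (key 1 - key (-1)) - (1 / 48 : ℝ) * (key 2 - key (-2))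

theorem hasGradientAt_inner_mul_self {E : Type*} [NormedAddCommGroup E] [InnerProductSpace ℝ E]
    [FiniteDimensional ℝ E] {L : E →ₗ[ℝ] E →ₗ[ℝ] E} (hcomm : ∀ x y, L x y = L y x)
    (hsymm : ∀ x y z, ⟪L x y, z⟫ = ⟪y, L x z⟫) (x : E) :
    HasGradientAt (fun x => ⟪L x x, x⟫) ((3 : ℝ) • L x x) x := by
  have h1 : HasFDerivAt (fun x => L.toContinuousBilinearMap x x) _ x :=
    L.toContinuousBilinearMap.hasFDerivAt_of_bilinear (hasFDerivAt_id x) (hasFDerivAt_id x)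
  have h2 := h1.inner ℝ (hasFDerivAt_id x)
  rw [hasGradientAt_iff_hasFDerivAt]
  refine h2.congr_fderiv ?_
  ext y
  simp [hcomm y x, hsymm, inner_add_left]
  rw [← hsymm, real_inner_comm (L x x) y]
  ring

end CubicForm

namespace MvPolynomial

theorem pderiv_pderiv_comm {σ R : Type*} [CommRing R] (i j : σ) (p : MvPolynomial σ R) :
    pderiv i (pderiv j p) = pderiv j (pderiv i p) := by
  classical
  have h : ⁅(pderiv i : Derivation R (MvPolynomial σ R) (MvPolynomial σ R)),
      (pderiv j : Derivation R _ _)⁆ = 0 := by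
    refine derivation_ext (A := MvPolynomial σ R) fun k => ?_
    rw [Derivation.commutator_apply, pderiv_X, pderiv_X]
    simp [Pi.single_apply, apply_ite]
  rw [← sub_eq_zero, ← Derivation.commutator_apply, h, Derivation.zero_apply]

theorem IsHomogeneous.eval_eq_eval_zero {σ R : Type*} [CommSemiring R] {p : MvPolynomial σ R}
    (hp : p.IsHomogeneous 0) (x : σ → R) : eval x p = eval 0 p := by
  rw [← totalDegree_zero_iff_isHomogeneous, totalDegree_eq_zero_iff_eq_C] at hp
  rw [hp, eval_C, eval_C]

theorem IsHomogeneous.sum_mul_eval_pderiv {σ R : Type*} [Fintype σ] [CommSemiring R]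
    {p : MvPolynomial σ R} {m : ℕ} (hp : p.IsHomogeneous m) (x : σ → R) :
    ∑ i, x i * eval x (pderiv i p) = m * eval x p := by
  have h := congrArg (eval x) hp.sum_X_mul_pderiv
  simpa using h

end MvPolynomial

section CubicPolynomial

open MvPolynomial

variable {n : ℕ}

/-- The bilinear multiplication on `ℝⁿ` whose structure constants are one sixth of the third
derivatives of `P` at the origin. -/
def cubicMul (P : MvPolynomial (Fin n) ℝ) : EuclideanSpace ℝ (Fin n) →ₗ[ℝ]
    EuclideanSpace ℝ (Fin n) →ₗ[ℝ] EuclideanSpace ℝ (Fin n) :=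
  LinearMap.mk₂ ℝ
    (fun x y => WithLp.toLp 2 fun i =>
      (1 / 6 : ℝ) * ∑ j, ∑ k, x j * y k * eval 0 (pderiv i (pderiv j (pderiv k P))))
    (fun x x' y => by
      ext i
      simp [add_mul, mul_add, Finset.sum_add_distrib])
    (fun c x y => by
      ext i
      simp only [PiLp.smul_apply, smul_eq_mul, Finset.mul_sum]
      exact Finset.sum_congr rfl fun j _ => Finset.sum_congr rfl fun k _ => by ring)
    (fun x y y' => by
      ext i
      simp [add_mul, mul_add, Finset.sum_add_distrib])
    (fun c x y => by
      ext i
      simp only [PiLp.smul_apply, smul_eq_mul, Finset.mul_sum]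
      exact Finset.sum_congr rfl fun j _ => Finset.sum_congr rfl fun k _ => by ring)

theorem cubicMul_apply (P : MvPolynomial (Fin n) ℝ) (x y : EuclideanSpace ℝ (Fin n)) (i : Fin n) :
    cubicMul P x y i =
      (1 / 6 : ℝ) * ∑ j, ∑ k, x j * y k * eval 0 (pderiv i (pderiv j (pderiv k P))) :=
  rfl

theorem cubicMul_comm (P : MvPolynomial (Fin n) ℝ) (x y : EuclideanSpace ℝ (Fin n)) :
    cubicMul P x y = cubicMul P y x := by
  ext i
  rw [cubicMul_apply, cubicMul_apply, Finset.sum_comm]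
  simp_rw [pderiv_pderiv_comm _ _ P, mul_comm (x _)]

theorem inner_cubicMul (P : MvPolynomial (Fin n) ℝ) (x y z : EuclideanSpace ℝ (Fin n)) :
    ⟪cubicMul P x y, z⟫ = (1 / 6 : ℝ) * ∑ j, ∑ k, ∑ i,
      x j * y k * z i * eval 0 (pderiv i (pderiv j (pderiv k P))) := by
  simp only [PiLp.inner_apply, cubicMul_apply, RCLike.inner_apply, conj_trivial, Finset.mul_sum]
  rw [Finset.sum_comm]
  refine Finset.sum_congr rfl fun j _ => ?_
  rw [Finset.sum_comm]
  refine Finset.sum_congr rfl fun k _ => Finset.sum_congr rfl fun i _ => ?_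
  ring

theorem cubicMul_symm (P : MvPolynomial (Fin n) ℝ) (x y z : EuclideanSpace ℝ (Fin n)) :
    ⟪cubicMul P x y, z⟫ = ⟪y, cubicMul P x z⟫ := by
  rw [real_inner_comm (cubicMul P x z) y, inner_cubicMul, inner_cubicMul]
  congr 1
  refine Finset.sum_congr rfl fun j _ => ?_
  rw [Finset.sum_comm]
  refine Finset.sum_congr rfl fun i _ => Finset.sum_congr rfl fun k _ => ?_
  rw [pderiv_pderiv_comm i j, pderiv_pderiv_comm i k, pderiv_pderiv_comm k j]
  ring

theorem eval_pderiv_pderiv {P : MvPolynomial (Fin n) ℝ} (hP : P.IsHomogeneous 3)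
    (x : EuclideanSpace ℝ (Fin n)) (j k : Fin n) :
    eval (fun i => x i) (pderiv j (pderiv k P)) =
      ∑ i, x i * eval 0 (pderiv i (pderiv j (pderiv k P))) := by
  have h1 : (pderiv j (pderiv k P)).IsHomogeneous 1 := hP.pderiv.pderiv
  have h2 := h1.sum_mul_eval_pderiv fun i => x i
  rw [Nat.cast_one, one_mul] at h2
  rw [← h2]
  exact Finset.sum_congr rfl fun i _ => by rw [h1.pderiv.eval_eq_eval_zero]

theorem inner_cubicMul_self {P : MvPolynomial (Fin n) ℝ} (hP : P.IsHomogeneous 3)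
    (x : EuclideanSpace ℝ (Fin n)) : ⟪cubicMul P x x, x⟫ = eval (fun i => x i) P := by
  have h1 := hP.sum_mul_eval_pderiv fun i => x i
  have h2 (k : Fin n) := (hP.pderiv (i := k)).sum_mul_eval_pderiv fun i => x i
  have h3 : 6 * eval (fun i => x i) P = ∑ k, ∑ j, ∑ i,
      x k * (x j * (x i * eval 0 (pderiv i (pderiv j (pderiv k P))))) := by
    simp_rw [← Finset.mul_sum, ← eval_pderiv_pderiv hP, h2]
    push_cast at h1 ⊢
    simp_rw [mul_left_comm _ (2 : ℝ), ← Finset.mul_sum, h1]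
    ring
  rw [inner_cubicMul, Finset.sum_comm]
  have h4 : ∀ i j k : Fin n, x j * x k * x i * eval 0 (pderiv i (pderiv j (pderiv k P))) =
      x k * (x j * (x i * eval 0 (pderiv i (pderiv j (pderiv k P))))) := fun i j k => by ring
  simp_rw [h4]
  rw [← h3]
  ring

theorem sum_eval_pderiv_pderiv_self {P : MvPolynomial (Fin n) ℝ} (hP : P.IsHomogeneous 3)
    (x : EuclideanSpace ℝ (Fin n)) :
    ∑ i, eval (fun j => x j) (pderiv i (pderiv i P)) =
      6 * LinearMap.trace ℝ _ (cubicMul P x) := by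
  rw [LinearMap.trace_eq_sum_inner _ (EuclideanSpace.basisFun (Fin n) ℝ), Finset.mul_sum]
  refine Finset.sum_congr rfl fun i _ => ?_
  rw [eval_pderiv_pderiv hP, EuclideanSpace.basisFun_apply, EuclideanSpace.inner_single_left,
    cubicMul_apply]
  simp [pderiv_pderiv_comm i]

end CubicPolynomial

/-- Any cubic homogeneous polynomial solution of `‖∇F(x)‖² = 9‖x‖⁴` is either a Cartan–Münzner
cubic or, up to sign, `4⟨x,e⟩³ - 3⟨x,e⟩‖x‖²` for a unit vector `e`. -/
theorem cubic_classification {n : ℕ} (hn : 2 ≤ n)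
    (F : EuclideanSpace ℝ (Fin n) → ℝ) (hF : IsHomPoly n 3 F)
    (hgrad : ∀ x : EuclideanSpace ℝ (Fin n), ‖gradient F x‖ ^ 2 = 9 * ‖x‖ ^ 4) :
    IsCartanMunzner n 3 F ∨
      ∃ e : EuclideanSpace ℝ (Fin n), ‖e‖ = 1 ∧
        ∃ ε : ℝ, (ε = 1 ∨ ε = -1) ∧
          ∀ x : EuclideanSpace ℝ (Fin n),
            F x = ε * (4 * ⟪x, e⟫ ^ 3 - 3 * ⟪x, e⟫ * ‖x‖ ^ 2) := by
  obtain ⟨P, hP, hFP⟩ := hF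
  have hFL : F = fun x => ⟪cubicMul P x x, x⟫ := by
    ext x
    rw [hFP, inner_cubicMul_self hP]
  have hL : IsEiconalMul (cubicMul P) := by
    refine .of_norm_sq (cubicMul_comm P) (cubicMul_symm P) fun x => ?_
    have h1 := hgrad x
    rw [hFL, (hasGradientAt_inner_mul_self (cubicMul_comm P) (cubicMul_symm P) x).gradient,
      norm_smul, mul_pow] at h1
    norm_num at h1
    exact h1
  rcases hL.traceless_or_reflection (by simpa using hn) with ⟨htr, m, hm, hnm⟩ | ⟨e, he, hLe⟩
  · have hm' : ((n : ℝ) - 2) / 3 = m := by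
      rw [finrank_euclideanSpace_fin] at hnm
      rw [hnm]
      push_cast
      ring
    refine Or.inl ⟨P, hP, hFP, fun x => ?_, 0, fun x => ?_, ⟨m, hm, ?_⟩, ⟨m, hm, ?_⟩⟩
    · rw [hgrad]
      norm_num
    · rw [sum_eval_pderiv_pderiv_self hP, htr, mul_zero, zero_mul]
    · simpa using hm'
    · simpa using hm'
  · refine Or.inr ⟨e, he, 1, Or.inl rfl, fun x => ?_⟩
    rw [hFL, one_mul]
    exact hL.inner_sq_self_of_reflection hLe x
end
end

section
/- Let m and p be positive integers and let h : ℝ → ℝ be continuous on [−1,1], real-analytic on (−1,1), and not constant on [−1,1], such that for all t ∈ (−1,1) one has p²·(h'(t))²·(1 − t²) = m²·(1 − h(t)²). Then there exists C ∈ ℝ such that h(t) = cos((m/p)·arccos t + C) for all t ∈ [−1,1]. -/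
noncomputable section

/-- The point `(a, b)` of the unit circle is `(cos C, sin C)` for some `C`. -/
theorem exists_cos_sin_eq_of_sq_add_sq_eq_one {a b : ℝ} (hab : a ^ 2 + b ^ 2 = 1) :
    ∃ C : ℝ, Real.cos C = a ∧ Real.sin C = b := by
  have hz : ‖(⟨a, b⟩ : ℂ)‖ = 1 := by
    rw [Complex.norm_def, Complex.normSq_mk, ← sq, ← sq, hab, Real.sqrt_one]
  have hz0 : (⟨a, b⟩ : ℂ) ≠ 0 := by
    intro h0
    simp [h0] at hz
  refine ⟨Complex.arg ⟨a, b⟩, ?_, ?_⟩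
  · rw [Complex.cos_arg hz0, hz, div_one]
  · rw [Complex.sin_arg, hz, div_one]

/-- Differentiating the first-order equation: a solution that is analytic on `(-1, 1)` and whose
derivative does not vanish identically satisfies the second-order Chebyshev equation. -/
theorem chebyshev_ode_of_sq_ode {m p : ℝ} {h : ℝ → ℝ}
    (hanal : AnalyticOnNhd ℝ h (Set.Ioo (-1 : ℝ) 1))
    (hnc : ¬ ∀ t ∈ Set.Ioo (-1 : ℝ) 1, deriv h t = 0)
    (hode : ∀ t ∈ Set.Ioo (-1 : ℝ) 1,
      p ^ 2 * (deriv h t) ^ 2 * (1 - t ^ 2) = m ^ 2 * (1 - h t ^ 2)) :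
    ∀ t ∈ Set.Ioo (-1 : ℝ) 1,
      p ^ 2 * (deriv (deriv h) t * (1 - t ^ 2) - t * deriv h t) + m ^ 2 * h t = 0 := by
  have hd := hanal.deriv
  have hG : AnalyticOnNhd ℝ
      (fun t ↦ p ^ 2 * (deriv (deriv h) t * (1 - t ^ 2) - t * deriv h t) + m ^ 2 * h t)
      (Set.Ioo (-1 : ℝ) 1) := by
    intro t ht
    have h0 := hanal t ht
    have h1 := hd t ht
    have h2 := hd.deriv t ht
    fun_prop
  refine (AnalyticOnNhd.eq_zero_or_eq_zero_of_mul_eq_zero hd hG ?_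
    isPreconnected_Ioo).resolve_left hnc
  intro t ht
  have h1 := (hanal t ht).differentiableAt.hasDerivAt
  have h2 := (hd t ht).differentiableAt.hasDerivAt
  have hL := ((h2.pow 2).const_mul (p ^ 2)).mul (((hasDerivAt_id t).pow 2).const_sub 1)
  have hR := ((h1.pow 2).const_sub 1).const_mul (m ^ 2)
  have hE := hL.unique (hR.congr_of_eventuallyEq
    (Filter.eventuallyEq_of_mem (isOpen_Ioo.mem_nhds ht) fun s hs ↦ hode s hs))
  simp at hE
  linear_combination hE / 2

/-- If `h` solves the Chebyshev equation on `(-1, 1)`, then `x ↦ h (cos x)` is a combination of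
`cos (k x)` and `sin (k x)` on `(0, π)`, whose coefficients are first integrals. -/
theorem chebyshev_ode_first_integrals {k : ℝ} (hk : k ≠ 0) {h : ℝ → ℝ}
    (hanal : AnalyticOnNhd ℝ h (Set.Ioo (-1 : ℝ) 1))
    (hode : ∀ t ∈ Set.Ioo (-1 : ℝ) 1,
      deriv (deriv h) t * (1 - t ^ 2) - t * deriv h t + k ^ 2 * h t = 0) :
    ∃ a b : ℝ, ∀ x ∈ Set.Ioo 0 Real.pi,
      h (Real.cos x) = a * Real.cos (k * x) + b * Real.sin (k * x) ∧
      deriv h (Real.cos x) * Real.sin x =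
        k * (a * Real.sin (k * x) - b * Real.cos (k * x)) := by
  have hmem : ∀ x ∈ Set.Ioo 0 Real.pi, Real.cos x ∈ Set.Ioo (-1 : ℝ) 1 := by
    intro x hx
    have hs := Real.sin_pos_of_mem_Ioo hx
    have := Real.sin_sq_add_cos_sq x
    constructor <;> nlinarith
  have hu : ∀ x ∈ Set.Ioo 0 Real.pi, HasDerivAt (fun x ↦ h (Real.cos x))
      (deriv h (Real.cos x) * -Real.sin x) x := fun x hx ↦
    (hanal _ (hmem x hx)).differentiableAt.hasDerivAt.comp x (Real.hasDerivAt_cos x)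
  have hv : ∀ x ∈ Set.Ioo 0 Real.pi, HasDerivAt (fun x ↦ deriv h (Real.cos x) * Real.sin x)
      (k ^ 2 * h (Real.cos x)) x := by
    intro x hx
    refine (((hanal.deriv _ (hmem x hx)).differentiableAt.hasDerivAt.comp x
      (Real.hasDerivAt_cos x)).mul (Real.hasDerivAt_sin x)).congr_deriv ?_
    simp only [Function.comp_apply]
    linear_combination -deriv (deriv h) (Real.cos x) * Real.sin_sq_add_cos_sq x
      - hode _ (hmem x hx)
  have hc : ∀ x, HasDerivAt (fun x ↦ Real.cos (k * x)) (-Real.sin (k * x) * k) x := fun x ↦ by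
    simpa using ((hasDerivAt_id x).const_mul k).cos
  have hs : ∀ x, HasDerivAt (fun x ↦ Real.sin (k * x)) (Real.cos (k * x) * k) x := fun x ↦ by
    simpa using ((hasDerivAt_id x).const_mul k).sin
  have hA : ∀ x ∈ Set.Ioo 0 Real.pi, HasDerivAt (fun x ↦ h (Real.cos x) * Real.cos (k * x) +
      deriv h (Real.cos x) * Real.sin x * Real.sin (k * x) / k) 0 x := by
    intro x hx
    refine (((hu x hx).mul (hc x)).add (((hv x hx).mul (hs x)).div_const k)).congr_deriv ?_
    field_simp
    ring
  have hB : ∀ x ∈ Set.Ioo 0 Real.pi, HasDerivAt (fun x ↦ h (Real.cos x) * Real.sin (k * x) -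
      deriv h (Real.cos x) * Real.sin x * Real.cos (k * x) / k) 0 x := by
    intro x hx
    refine (((hu x hx).mul (hs x)).sub (((hv x hx).mul (hc x)).div_const k)).congr_deriv ?_
    field_simp
    ring
  obtain ⟨a, ha⟩ := isOpen_Ioo.exists_is_const_of_deriv_eq_zero isPreconnected_Ioo
    (fun x hx ↦ (hA x hx).differentiableAt.differentiableWithinAt) fun x hx ↦ (hA x hx).deriv
  obtain ⟨b, hb⟩ := isOpen_Ioo.exists_is_const_of_deriv_eq_zero isPreconnected_Ioo
    (fun x hx ↦ (hB x hx).differentiableAt.differentiableWithinAt) fun x hx ↦ (hB x hx).deriv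
  refine ⟨a, b, fun x hx ↦ ?_⟩
  have hk1 := Real.sin_sq_add_cos_sq (k * x)
  rw [← ha x hx, ← hb x hx]
  constructor
  · field_simp
    linear_combination -k * h (Real.cos x) * hk1
  · field_simp
    linear_combination -deriv h (Real.cos x) * Real.sin x * hk1

/-- A non-constant real-analytic solution on `(-1,1)` of the ODE
`p²·h'(t)²·(1 - t²) = m²·(1 - h(t)²)`, continuous on `[-1,1]`, has the form
`h(t) = cos((m/p)·arccos t + C)`. -/
theorem ode_solution_is_cos_arccos {m p : ℕ} (hm : 0 < m) (hp : 0 < p) (h : ℝ → ℝ)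
    (hcont : ContinuousOn h (Set.Icc (-1 : ℝ) 1))
    (hanal : AnalyticOnNhd ℝ h (Set.Ioo (-1 : ℝ) 1))
    (hnc : ¬ ∀ s ∈ Set.Icc (-1 : ℝ) 1, ∀ t ∈ Set.Icc (-1 : ℝ) 1, h s = h t)
    (hode : ∀ t ∈ Set.Ioo (-1 : ℝ) 1,
      (p : ℝ) ^ 2 * (deriv h t) ^ 2 * (1 - t ^ 2) = (m : ℝ) ^ 2 * (1 - h t ^ 2)) :
    ∃ C : ℝ, ∀ t ∈ Set.Icc (-1 : ℝ) 1,
      h t = Real.cos ((m : ℝ) / (p : ℝ) * Real.arccos t + C) := by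
  have hclosure : Set.Icc (-1 : ℝ) 1 ⊆ closure (Set.Ioo (-1 : ℝ) 1) := by
    rw [closure_Ioo (by norm_num)]
  have hp0 : (p : ℝ) ≠ 0 := by positivity
  have hk0 : (m : ℝ) / p ≠ 0 := by positivity
  have hderiv : ¬ ∀ t ∈ Set.Ioo (-1 : ℝ) 1, deriv h t = 0 := by
    intro h0
    obtain ⟨c, hc⟩ := isOpen_Ioo.exists_is_const_of_deriv_eq_zero isPreconnected_Ioo
      (fun t ht ↦ (hanal t ht).differentiableAt.differentiableWithinAt) h0
    have hc' : Set.EqOn h (fun _ ↦ c) (Set.Icc (-1 : ℝ) 1) :=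
      Set.EqOn.of_subset_closure hc hcont continuousOn_const Set.Ioo_subset_Icc_self hclosure
    exact hnc fun s hs t ht ↦ (hc' hs).trans (hc' ht).symm
  obtain ⟨a, b, hab⟩ := chebyshev_ode_first_integrals hk0 hanal fun t ht ↦ by
    have := chebyshev_ode_of_sq_ode hanal hderiv hode t ht
    field_simp
    linear_combination this
  have hcirc : a ^ 2 + (-b) ^ 2 = 1 := by
    have hx : Real.pi / 2 ∈ Set.Ioo 0 Real.pi := ⟨by positivity, by linarith [Real.pi_pos]⟩
    obtain ⟨h0, h1⟩ := hab _ hx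
    have he := hode 0 (by norm_num)
    rw [Real.cos_pi_div_two] at h0 h1
    rw [Real.sin_pi_div_two, mul_one] at h1
    rw [h0, h1] at he
    have hm0 : (m : ℝ) ^ 2 ≠ 0 := by positivity
    rw [mul_pow, div_pow, ← mul_assoc, mul_div_cancel₀ _ (pow_ne_zero 2 hp0), mul_assoc] at he
    linear_combination mul_left_cancel₀ hm0 he -
      (a ^ 2 + b ^ 2) * Real.sin_sq_add_cos_sq (m / p * (Real.pi / 2))
  obtain ⟨C, rfl, hC⟩ := exists_cos_sin_eq_of_sq_add_sq_eq_one hcirc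
  refine ⟨C, Set.EqOn.of_subset_closure (s := Set.Ioo (-1 : ℝ) 1) ?_ hcont ?_
    Set.Ioo_subset_Icc_self hclosure⟩
  · intro t ht
    have hx : Real.arccos t ∈ Set.Ioo 0 Real.pi :=
      ⟨Real.arccos_pos.2 ht.2, Real.arccos_lt_pi.2 ht.1⟩
    have h0 := (hab _ hx).1
    rw [Real.cos_arccos ht.1.le ht.2.le] at h0
    beta_reduce
    rw [h0, Real.cos_add, hC]
    ring
  · fun_prop
end
end

section
/- Let m and p be positive integers, let C ∈ ℝ, and define h : [−1,1] → ℝ by h(t) = cos((m/p)·arccos t + C). If h(1)² = 1 and h(−1)² = 1, then p divides m and there exists a sign ε ∈ {1,−1} such that h(t) = ε·T_{m/p}(t) for all t ∈ [−1,1], where T_k denotes the k-th Chebyshev polynomial of the first kind. -/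
noncomputable section

theorem Real.exists_int_mul_pi_of_cos_sq_eq_one {x : ℝ} (hx : Real.cos x ^ 2 = 1) :
    ∃ n : ℤ, (n : ℝ) * Real.pi = x :=
  Real.sin_eq_zero_iff.mp <| Real.sin_eq_zero_iff_cos_eq.mpr <| sq_eq_one_iff.mp hx

/-- If `h(t) = cos((m/p)·arccos t + C)` satisfies `h(1)² = 1` and `h(-1)² = 1`, then `p ∣ m`
and `h` is, up to sign, the Chebyshev polynomial `T_{m/p}` on `[-1,1]`. -/
theorem cos_arccos_is_chebyshev {m p : ℕ} (hm : 0 < m) (hp : 0 < p) (C : ℝ) (h : ℝ → ℝ)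
    (hh : ∀ t ∈ Set.Icc (-1 : ℝ) 1,
      h t = Real.cos ((m : ℝ) / (p : ℝ) * Real.arccos t + C))
    (h1 : h 1 ^ 2 = 1) (h2 : h (-1) ^ 2 = 1) :
    p ∣ m ∧ ∃ ε : ℝ, (ε = 1 ∨ ε = -1) ∧
      ∀ t ∈ Set.Icc (-1 : ℝ) 1,
        h t = ε * (Polynomial.Chebyshev.T ℝ ((m / p : ℕ) : ℤ)).eval t := by
  rw [hh 1 (by simp), Real.arccos_one, mul_zero, zero_add] at h1
  rw [hh (-1) (by simp), Real.arccos_neg_one] at h2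
  obtain ⟨a, ha⟩ := Real.exists_int_mul_pi_of_cos_sq_eq_one h1
  obtain ⟨b, hb⟩ := Real.exists_int_mul_pi_of_cos_sq_eq_one h2
  have hp0 : (p : ℝ) ≠ 0 := by positivity
  have hquot : (m : ℝ) / p = b - a :=
    mul_right_cancel₀ Real.pi_ne_zero (by linear_combination ha - hb)
  have hdvd : p ∣ m := by
    rw [← Int.natCast_dvd_natCast]
    refine ⟨b - a, ?_⟩
    rw [div_eq_iff hp0, mul_comm] at hquot
    exact_mod_cast hquot
  refine ⟨hdvd, Real.cos C, sq_eq_one_iff.mp h1, fun t ht => ?_⟩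
  have hT := Polynomial.Chebyshev.T_real_cos (Real.arccos t) ((m / p : ℕ) : ℤ)
  rw [Real.cos_arccos ht.1 ht.2, Int.cast_natCast, Nat.cast_div hdvd hp0] at hT
  rw [hh t ht, hT, ← ha, Real.cos_add_int_mul_pi, Real.cos_int_mul_pi]
end
end
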